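/- Let g be a classical Lie superalgebra and M an object of F = F(g, g_0̄). Then c_F(M) = 0 if and only if M is projective in F. -/

import Mathlib

/-!
# Framework: Lie superalgebras over ℂ and their supermodules

A ℤ/2-graded vector space is encoded by a carrier together with a pair of complementary
subspaces (`part 0`, `part 1`).  A Lie superalgebra is such a space with a bilinear
bracket which preserves the grading and satisfies the graded antisymmetry and graded
Jacobi identities (stated on homogeneous elements, with the sign `(-1)^{|x||y|}`).
A `g`-supermodule is a graded vector space with an action of `g` satisfying the graded
module axiom; morphisms are arbitrary (not necessarily grading-preserving) supermodule
homomorphisms, encoded by the sign-twisted intertwining condition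
`f(x·m) = x·(σ^{|x|} f (σ^{|x|} m))`, which for homogeneous `f` is exactly
`f(x·m) = (-1)^{|f||x|} x·f(m)`.
`F = F(g, g₀̄)` is the category of finite-dimensional supermodules which are completely
reducible over `g₀̄`, and `C(g, g₀̄)` that of all supermodules which are finitely
semisimple (sums of finite-dimensional simple `g₀̄`-submodules) over `g₀̄`.
-/

noncomputable section

open LinearMap Submodule Module

/-- The sign `(-1)^{ij}` attached to a pair of parities `i j : ℤ/2`. -/
def ssgn (i j : ZMod 2) : ℂ := if i = 1 ∧ j = 1 then -1 else 1

/-- A ℤ/2-graded (super) complex vector space. -/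
structure SuperVS : Type 1 where
  carrier : Type
  [addCommGroup : AddCommGroup carrier]
  [module : Module ℂ carrier]
  part : ZMod 2 → Submodule ℂ carrier
  isCompl : IsCompl (part 0) (part 1)

attribute [instance] SuperVS.addCommGroup SuperVS.module

namespace SuperVS

variable (W : SuperVS)

/-- The projection onto the even part along the odd part. -/
def projEven : W.carrier →ₗ[ℂ] W.carrier :=
  (W.part 0).subtype ∘ₗ (W.part 0).linearProjOfIsCompl (W.part 1) W.isCompl

/-- The projection onto the odd part along the even part. -/
def projOdd : W.carrier →ₗ[ℂ] W.carrier :=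
  (W.part 1).subtype ∘ₗ (W.part 1).linearProjOfIsCompl (W.part 0) W.isCompl.symm

/-- The projection onto the part of parity `p`. -/
def proj (p : ZMod 2) : W.carrier →ₗ[ℂ] W.carrier :=
  if p = 0 then W.projEven else W.projOdd

/-- The parity involution `σ` (identity on the even part, `-1` on the odd part). -/
def pty : W.carrier →ₗ[ℂ] W.carrier := W.projEven - W.projOdd

/-- `σ^i` for a parity `i : ℤ/2`. -/
def ptyPow (i : ZMod 2) : W.carrier →ₗ[ℂ] W.carrier :=
  if i = 0 then LinearMap.id else W.pty

/-- A subspace is graded if it is the (internal direct) sum of its graded pieces;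
equivalently, it is stable under the parity involution. -/
def IsGraded (U : Submodule ℂ W.carrier) : Prop :=
  ∀ m ∈ U, W.pty m ∈ U

end SuperVS

/-- A Lie superalgebra over `ℂ`: a super vector space with a grading-preserving bilinear
bracket satisfying the graded antisymmetry and graded Jacobi identities. -/
structure LieSuperAlgebra extends SuperVS where
  bracket : carrier →ₗ[ℂ] carrier →ₗ[ℂ] carrier
  bracket_grading : ∀ (i j : ZMod 2), ∀ x ∈ part i, ∀ y ∈ part j,
    bracket x y ∈ part (i + j)
  bracket_skew : ∀ (i j : ZMod 2), ∀ x ∈ part i, ∀ y ∈ part j,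
    bracket x y = -(ssgn i j) • bracket y x
  bracket_jacobi : ∀ (i j k : ZMod 2), ∀ x ∈ part i, ∀ y ∈ part j, ∀ z ∈ part k,
    bracket x (bracket y z) = bracket (bracket x y) z + ssgn i j • bracket y (bracket x z)

namespace LieSuperAlgebra

variable (g : LieSuperAlgebra)

/-- A `g`-supermodule: a super vector space with a `g`-action satisfying the graded
module axiom `[x,y]·m = x·(y·m) - (-1)^{|x||y|} y·(x·m)` and preserving the grading. -/
structure SuperModule extends SuperVS where
  act : g.carrier →ₗ[ℂ] carrier →ₗ[ℂ] carrier
  act_grading : ∀ (i j : ZMod 2), ∀ x ∈ g.part i, ∀ m ∈ part j,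
    act x m ∈ part (i + j)
  act_bracket : ∀ (i j : ZMod 2), ∀ x ∈ g.part i, ∀ y ∈ g.part j, ∀ m : carrier,
    act (g.bracket x y) m = act x (act y m) - ssgn i j • act y (act x m)

namespace SuperModule

variable {g}
variable (M N : g.SuperModule)

/-- A subspace stable under the action of the even part `g₀̄`. -/
def IsEvenStable (U : Submodule ℂ M.carrier) : Prop :=
  ∀ x ∈ g.part 0, ∀ m ∈ U, M.act x m ∈ U

/-- A subspace stable under the action of all of `g` (together with gradedness this is a
sub-supermodule). -/
def IsStable (U : Submodule ℂ M.carrier) : Prop :=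
  ∀ x : g.carrier, ∀ m ∈ U, M.act x m ∈ U

/-- A sub-supermodule: a graded `g`-stable subspace. -/
def IsSubSuper (U : Submodule ℂ M.carrier) : Prop :=
  M.toSuperVS.IsGraded U ∧ M.IsStable U

/-- `M` is completely reducible (semisimple) as a module over the even part `g₀̄`:
every `g₀̄`-stable subspace has a `g₀̄`-stable complement. -/
def IsCompletelyReducibleEven : Prop :=
  ∀ U : Submodule ℂ M.carrier, M.IsEvenStable U →
    ∃ U' : Submodule ℂ M.carrier, M.IsEvenStable U' ∧ IsCompl U U'

/-- Membership in the category `F = F(g, g₀̄)`: finite-dimensional and completely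
reducible over `g₀̄`. -/
def MemF : Prop :=
  FiniteDimensional ℂ M.carrier ∧ M.IsCompletelyReducibleEven

/-- Membership in the category `C(g, g₀̄)`: finitely semisimple over `g₀̄`, i.e. the sum
of the finite-dimensional simple `g₀̄`-submodules is everything. -/
def MemC : Prop :=
  sSup {U : Submodule ℂ M.carrier |
      M.IsEvenStable U ∧ FiniteDimensional ℂ U ∧ U ≠ ⊥ ∧
      ∀ U' ≤ U, M.IsEvenStable U' → U' = ⊥ ∨ U' = U} = ⊤

end SuperModule

/-- A homomorphism of `g`-supermodules (not necessarily grading-preserving): a linear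
map satisfying `f(x·m) = x·(σ^{|x|} (f (σ^{|x|} m)))` for `x` homogeneous of parity
`|x|`; for `f` homogeneous this is the usual sign rule `f(x·m) = (-1)^{|f||x|} x·f(m)`. -/
structure SuperHom (M N : g.SuperModule) where
  toLinearMap : M.carrier →ₗ[ℂ] N.carrier
  compat : ∀ (i : ZMod 2), ∀ x ∈ g.part i, ∀ m : M.carrier,
    toLinearMap (M.act x m)
      = N.act x (N.toSuperVS.ptyPow i (toLinearMap (M.toSuperVS.ptyPow i m)))

/-- Two supermodules are isomorphic in the category of `g`-supermodules. -/
def SuperIso (M N : g.SuperModule) : Prop :=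
  ∃ f : g.SuperHom M N, Function.Bijective f.toLinearMap

/-- `P` is a projective object of `F(g, g₀̄)`. -/
def IsProjectiveInF (P : g.SuperModule) : Prop :=
  P.MemF ∧
  ∀ (M N : g.SuperModule), M.MemF → N.MemF →
    ∀ (p : g.SuperHom M N), Function.Surjective p.toLinearMap →
    ∀ (f : g.SuperHom P N),
      ∃ h : g.SuperHom P M, p.toLinearMap ∘ₗ h.toLinearMap = f.toLinearMap

/-- `I` is an injective object of `F(g, g₀̄)`. -/
def IsInjectiveInF (I : g.SuperModule) : Prop :=
  I.MemF ∧
  ∀ (M N : g.SuperModule), M.MemF → N.MemF →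
    ∀ (ι : g.SuperHom M N), Function.Injective ι.toLinearMap →
    ∀ (f : g.SuperHom M I),
      ∃ h : g.SuperHom N I, h.toLinearMap ∘ₗ ι.toLinearMap = f.toLinearMap

/-- A simple supermodule: nonzero, with no proper nonzero sub-supermodule. -/
def IsSimple (S : g.SuperModule) : Prop :=
  (⊥ : Submodule ℂ S.carrier) ≠ ⊤ ∧
  ∀ U : Submodule ℂ S.carrier, S.IsSubSuper U → U = ⊥ ∨ U = ⊤

/-- `g` is a *classical* Lie superalgebra.  (In the paper this means that `g` is finite
dimensional and that there is a connected reductive algebraic group `G₀̄` with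
`Lie(G₀̄) = g₀̄` whose action on `g₁̄` differentiates to the adjoint action; we encode
the resulting representation-theoretic content: `g` is finite dimensional, `g₀̄` is
reductive in the sense that its adjoint action on itself is completely reducible, and
`g₁̄` is a semisimple `g₀̄`-module.) -/
structure IsClassical : Prop where
  finiteDimensional : FiniteDimensional ℂ g.carrier
  even_reducible : ∀ U : Submodule ℂ g.carrier,
    U ≤ g.part 0 → (∀ x ∈ g.part 0, ∀ y ∈ U, g.bracket x y ∈ U) →
    ∃ U', U' ≤ g.part 0 ∧ (∀ x ∈ g.part 0, ∀ y ∈ U', g.bracket x y ∈ U') ∧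
      U ⊓ U' = ⊥ ∧ U ⊔ U' = g.part 0
  odd_reducible : ∀ U : Submodule ℂ g.carrier,
    U ≤ g.part 1 → (∀ x ∈ g.part 0, ∀ y ∈ U, g.bracket x y ∈ U) →
    ∃ U', U' ≤ g.part 1 ∧ (∀ x ∈ g.part 0, ∀ y ∈ U', g.bracket x y ∈ U') ∧
      U ⊓ U' = ⊥ ∧ U ⊔ U' = g.part 1

/-- A Type I (consistent ℤ-)grading `g = g₋₁ ⊕ g₀ ⊕ g₁` with `g₀̄ = g₀` and
`g₁̄ = g₋₁ ⊕ g₁`.  The conditions `[g₁,g₁] = [g₋₁,g₋₁] = 0` and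
`[g₀,g₊₁] ⊆ g₊₁`, `[g₀,g₋₁] ⊆ g₋₁` express compatibility of the ℤ-grading with the
bracket (the remaining compatibilities are automatic). -/
structure TypeIStructure where
  neg : Submodule ℂ g.carrier
  pos : Submodule ℂ g.carrier
  inf_eq_bot : neg ⊓ pos = ⊥
  sup_eq_odd : neg ⊔ pos = g.part 1
  even_neg : ∀ x ∈ g.part 0, ∀ y ∈ neg, g.bracket x y ∈ neg
  even_pos : ∀ x ∈ g.part 0, ∀ y ∈ pos, g.bracket x y ∈ pos
  neg_neg : ∀ x ∈ neg, ∀ y ∈ neg, g.bracket x y = 0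
  pos_pos : ∀ x ∈ pos, ∀ y ∈ pos, g.bracket x y = 0

/-- The support (rank) variety of `M` over an odd abelian (sub)algebra `W ⊆ g₁̄`:
`{x ∈ W | M is not projective as a U(⟨x⟩)-module} ∪ {0}`.  For `x` with `[x,x] = 0` the
module `M` is projective over `U(⟨x⟩) ≅ ℂ[x]/(x²)` precisely when `Ker x = Im x` on `M`. -/
def suppVariety (W : Submodule ℂ g.carrier) (M : g.SuperModule) : Set g.carrier :=
  {x | x ∈ W ∧ LinearMap.ker (M.act x) ≠ LinearMap.range (M.act x)} ∪ {0}

end LieSuperAlgebra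

/-!
# Projective resolutions, rate of growth, and complexity in `F(g, g₀̄)`
-/

namespace LieSuperAlgebra

variable (g : LieSuperAlgebra)

/-- A projective resolution `⋯ → P₁ → P₀ → M → 0` of `M` in the category `F(g, g₀̄)`. -/
structure ProjResF (M : g.SuperModule) where
  P : ℕ → g.SuperModule
  d : ∀ n : ℕ, g.SuperHom (P (n + 1)) (P n)
  aug : g.SuperHom (P 0) M
  projective : ∀ n, g.IsProjectiveInF (P n)
  aug_surjective : Function.Surjective aug.toLinearMap
  exact_at_zero : LinearMap.range (d 0).toLinearMap = LinearMap.ker aug.toLinearMap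
  exact : ∀ n, LinearMap.range (d (n + 1)).toLinearMap = LinearMap.ker (d n).toLinearMap

/-- A minimal projective resolution: one whose terms have the smallest possible
dimensions (a minimal resolution is a direct summand of any projective resolution). -/
def ProjResF.IsMinimal {M : g.SuperModule} (R : g.ProjResF M) : Prop :=
  ∀ R' : g.ProjResF M, ∀ n : ℕ,
    Module.finrank ℂ (R.P n).carrier ≤ Module.finrank ℂ (R'.P n).carrier

end LieSuperAlgebra

/-- `f` grows at rate at most `c`: there is `C > 0` with `f t ≤ C · t^{c-1}` for all
`t ≥ 1`. -/
def HasGrowthRateLE (f : ℕ → ℕ) (c : ℕ) : Prop :=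
  ∃ C : ℝ, 0 < C ∧ ∀ t : ℕ, 1 ≤ t → (f t : ℝ) ≤ C * (t : ℝ) ^ ((c : ℝ) - 1)

/-- The rate of growth `r(V_•)` of a sequence of dimensions: the smallest nonnegative
integer `c` such that `dim V_t ≤ C t^{c-1}` for some constant `C > 0`, or `⊤` if no such
integer exists. -/
def growthRate (f : ℕ → ℕ) : ℕ∞ :=
  sInf {c : ℕ∞ | ∃ c' : ℕ, c = (c' : ℕ∞) ∧ HasGrowthRateLE f c'}

/-- The sequence of dimensions of the terms of a projective resolution. -/
def LieSuperAlgebra.ProjResF.dims {g : LieSuperAlgebra} {M : g.SuperModule}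
    (R : g.ProjResF M) : ℕ → ℕ :=
  fun n => Module.finrank ℂ (R.P n).carrier

/-!
STATEMENT 5: For a classical Lie superalgebra `g` and `M` in `F = F(g, g₀̄)`, the
complexity `c_F(M)` is zero if and only if `M` is projective in `F`.
-/

section WeylReducibility

variable {K L W : Type*} [Field K] [LieRing L] [LieAlgebra K L]
  [AddCommGroup W] [Module K W] [LieRingModule L W] [LieModule K L W]

/-- A perfect ideal acting with vanishing trace form acts trivially. -/
lemma lie_eq_zero_of_perfect_of_traceForm_eq_zero [CharZero K] [FiniteDimensional K W]
    [FiniteDimensional K L]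
    (D : LieIdeal K L) (hD : ⁅D, D⁆ = D)
    (ht : ∀ x ∈ D, ∀ y ∈ D, LieModule.traceForm K L W x y = 0) :
    ∀ x ∈ D, ∀ w : W, ⁅x, w⁆ = 0 := by
  have htf : LieModule.traceForm K D W = 0 := by
    ext ⟨x, hx⟩ ⟨y, hy⟩
    exact ht x hx y hy
  have hnil : LieModule.IsNilpotent D W := by
    rw [LieModule.isNilpotent_iff_forall' (R := K)]
    rintro ⟨x, hx⟩
    have h1 := LieModule.isNilpotent_derivedSeries_of_traceForm_eq_zero htf
    refine (LieModule.isNilpotent_iff_forall' (R := K)).mp h1 ⟨⟨x, hx⟩, ?_⟩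
    rw [LieIdeal.derivedSeries_eq_derivedSeriesOfIdeal_comap, LieIdeal.mem_comap]
    rw [LieAlgebra.derivedSeriesOfIdeal_succ, LieAlgebra.derivedSeriesOfIdeal_zero, hD]
    exact hx
  obtain ⟨k, hk⟩ := (LieModule.isNilpotent_iff K D W).mp hnil
  set F := LieModule.lowerCentralSeries K D W with hF
  have key : ∀ m : ℕ, ∀ x ∈ D, ∀ j : ℕ, ∀ w ∈ F j, ⁅x, w⁆ ∈ F (j + m + 1) := by
    intro m
    induction m with
    | zero =>
      intro x hx j w hw
      rw [hF, Nat.add_zero, LieModule.lowerCentralSeries_succ]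
      exact LieSubmodule.lie_mem_lie (LieSubmodule.mem_top (⟨x, hx⟩ : D)) hw
    | succ m ih =>
      intro x hx j w hw
      have hx' : x ∈ (⁅D, D⁆ : LieIdeal K L).toSubmodule := by rw [hD]; exact hx
      rw [LieSubmodule.lieIdeal_oper_eq_linear_span'] at hx'
      clear hx
      induction hx' using Submodule.span_induction with
      | mem x h =>
        obtain ⟨a, ha, b, hb, rfl⟩ := h
        rw [lie_lie]
        have hle : F (j + m + 1 + m + 1) ≤ F (j + (m + 1) + 1) :=
          LieModule.antitone_lowerCentralSeries K D W (by omega)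
        exact sub_mem (hle (ih a ha _ _ (ih b hb _ _ hw))) (hle (ih b hb _ _ (ih a ha _ _ hw)))
      | zero => simp
      | add x y _ _ h1 h2 => rw [add_lie]; exact add_mem h1 h2
      | smul c x _ h => rw [smul_lie]; exact (F _).smul_mem c h
  intro x hx w
  have h := key k x hx 0 w (by simp [hF])
  have h2 : ⁅x, w⁆ ∈ F k :=
    LieModule.antitone_lowerCentralSeries K D W (show k ≤ 0 + k + 1 by omega) h
  rw [hk] at h2
  simpa using h2

/-- In a Lie algebra all of whose ideals are complemented, the radical of the trace form of a
module killed by the centre acts trivially. -/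
lemma lie_eq_zero_of_mem_ker_traceForm [CharZero K] [FiniteDimensional K W]
    [FiniteDimensional K L] (hL : ∀ I : LieIdeal K L, ∃ J : LieIdeal K L, IsCompl I J)
    (hZ : ∀ z ∈ LieAlgebra.center K L, ∀ w : W, ⁅z, w⁆ = 0)
    (N : LieIdeal K L) (hN : ∀ x ∈ N, ∀ y : L, LieModule.traceForm K L W x y = 0) :
    ∀ x ∈ N, ∀ w : W, ⁅x, w⁆ = 0 := by
  obtain ⟨J, hJ⟩ := hL N
  set D : LieIdeal K L := ⁅N, N⁆ with hDdef
  have hDN : D ≤ N := LieSubmodule.lie_le_left N N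
  obtain ⟨A', hA'⟩ := hL D
  set A : LieIdeal K L := A' ⊓ N with hA
  have hDA : D ⊔ A = N := by
    rw [hA, ← sup_inf_assoc_of_le A' hDN, hA'.sup_eq_top, top_inf_eq]
  have hdisj : D ⊓ A = ⊥ := by
    rw [hA, ← inf_assoc, hA'.inf_eq_bot, bot_inf_eq]
  have hAN : ⁅A, N⁆ = ⊥ := by
    rw [eq_bot_iff, ← hdisj]
    exact le_inf (LieSubmodule.mono_lie_left N inf_le_right) (LieSubmodule.lie_le_left A N)
  have hAJ : ⁅A, J⁆ = ⊥ := by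
    rw [eq_bot_iff, ← hJ.inf_eq_bot]
    exact le_inf ((LieSubmodule.lie_le_left A J).trans inf_le_right) (LieSubmodule.lie_le_right J A)
  have hAc : ∀ a ∈ A, a ∈ LieAlgebra.center K L := by
    have hAt : ⁅A, (⊤ : LieIdeal K L)⁆ = ⊥ := by
      rw [← hJ.sup_eq_top, LieSubmodule.lie_sup, hAN, hAJ, sup_bot_eq]
    intro a ha
    rw [LieModule.mem_maxTrivSubmodule]
    intro x
    have h := LieSubmodule.lie_mem_lie ha (LieSubmodule.mem_top (R := K) (L := L) x)
    rw [hAt, LieSubmodule.mem_bot] at h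
    rw [← lie_skew, h, neg_zero]
  have hD : ⁅D, D⁆ = D := by
    have hAD : ⁅A, D⁆ = ⊥ := by
      rw [eq_bot_iff, ← hAN]; exact LieSubmodule.mono_lie_right A hDN
    have hAA : ⁅A, A⁆ = ⊥ := by
      rw [eq_bot_iff, ← hAN]; exact LieSubmodule.mono_lie_right A inf_le_right
    conv_rhs => rw [hDdef, ← hDA]
    rw [LieSubmodule.lie_sup, LieSubmodule.sup_lie, LieSubmodule.sup_lie, hAD, hAA,
      LieSubmodule.lie_comm D A, hAD]
    simp
  intro x hx w
  rw [← hDA, LieSubmodule.mem_sup] at hx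
  obtain ⟨d, hd, a, ha, rfl⟩ := hx
  rw [add_lie, hZ a (hAc a ha), add_zero]
  exact lie_eq_zero_of_perfect_of_traceForm_eq_zero D hD
    (fun x hx y _ => hN x (hDN hx) y) d hd w

/-- A Lie module on which some ideal `J` has nondegenerate trace form and a complement of `J` acts
trivially carries an equivariant endomorphism (the Casimir operator) of trace `dim J`, which is a
sum of products of operators from `L`. -/
lemma exists_casimir [FiniteDimensional K L]
    (N J : LieIdeal K L) (hNJ : IsCompl N J)
    (hN : ∀ x ∈ N, ∀ w : W, ⁅x, w⁆ = 0)
    (hnd : ∀ x ∈ J, (∀ y : L, LieModule.traceForm K L W x y = 0) → x = 0) :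
    ∃ C : Module.End K W, (∀ x : L, ∀ w : W, C ⁅x, w⁆ = ⁅x, C w⁆) ∧
      LinearMap.trace K W C = (finrank K J : K) ∧
      (∀ l : Dual K W, (∀ (x : L) (w : W), l ⁅x, w⁆ = 0) → l ∘ₗ C = 0) := by
  classical
  set t := LieModule.traceForm K L W with ht
  have hNt : ∀ x ∈ N, ∀ y, t y x = 0 := by
    intro x hx y
    have : LieModule.toEnd K L W x = 0 := by ext w; simpa using hN x hx w
    rw [ht, LieModule.traceForm_apply_apply, this, LinearMap.comp_zero, map_zero]
  have htop : ∀ y : L, ∃ a ∈ N, ∃ b ∈ J, a + b = y := by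
    intro y
    have : y ∈ N ⊔ J := by rw [hNJ.sup_eq_top]; exact LieSubmodule.mem_top y
    rwa [LieSubmodule.mem_sup] at this
  let B : LinearMap.BilinForm K J := t.restrict J.toSubmodule
  have hBsymm : B.IsSymm := ⟨fun x y => LieModule.traceForm_comm K L W x y⟩
  have hB : B.Nondegenerate := by
    refine (LinearMap.IsRefl.nondegenerate_iff_separatingLeft hBsymm.isRefl).mpr ?_
    rintro ⟨x, hx⟩ h
    have : x = 0 := by
      refine hnd x hx fun y => ?_
      obtain ⟨a, ha, b, hb, rfl⟩ := htop y
      rw [map_add, hNt a ha x, zero_add]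
      exact h ⟨b, hb⟩
    simpa using this
  let b := Module.finBasis K J
  let b' := B.dualBasis hB b
  let φ := LieModule.toEnd K L W
  have e1 : ∀ u : J, u = ∑ j, B u (b' j) • b j := by
    intro u
    have h := LinearMap.BilinForm.dualBasis_dualBasis hB hBsymm b
    conv_lhs => rw [← b.sum_repr u]
    refine Finset.sum_congr rfl fun j _ => ?_
    congr 1
    conv_lhs => rw [← h]
    rw [LinearMap.BilinForm.dualBasis_repr_apply]
  have e2 : ∀ u : J, u = ∑ j, B u (b j) • b' j := by
    intro u
    conv_lhs => rw [← b'.sum_repr u]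
    refine Finset.sum_congr rfl fun j _ => ?_
    rw [LinearMap.BilinForm.dualBasis_repr_apply]
  let C : Module.End K W := ∑ i, φ (b i : L) * φ (b' i : L)
  have hCapp : ∀ w, C w = ∑ i, ⁅(b i : L), ⁅(b' i : L), w⁆⁆ := by
    intro w
    simp [C, φ, LinearMap.sum_apply]
  refine ⟨C, ?_, ?_, ?_⟩
  · intro x w
    obtain ⟨a, ha, ⟨x, hx⟩, rfl⟩ : ∃ a ∈ N, ∃ y : J, a + (y : L) = x := by
      obtain ⟨a, ha, y, hy, h⟩ := htop x
      exact ⟨a, ha, ⟨y, hy⟩, h⟩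
    rw [add_lie, add_lie, hN a ha, hN a ha, zero_add, zero_add]
    have expand : ∀ u v : L, ⁅x, ⁅u, ⁅v, w⁆⁆⁆ - ⁅u, ⁅v, ⁅x, w⁆⁆⁆
        = ⁅⁅x, u⁆, ⁅v, w⁆⁆ + ⁅u, ⁅⁅x, v⁆, w⁆⁆ := by
      intro u v
      rw [lie_lie, lie_lie, lie_sub]; abel
    have s1 : ∀ i, ⁅⁅x, (b i : L)⁆, ⁅(b' i : L), w⁆⁆
        = ∑ j, t ⁅x, (b i : L)⁆ (b' j : L) • ⁅(b j : L), ⁅(b' i : L), w⁆⁆ := by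
      intro i
      have h := congrArg (fun u : J => (u : L)) (e1 ⟨⁅x, (b i : L)⁆, J.lie_mem (b i).2⟩)
      simp only [AddSubmonoidClass.coe_finsetSum, LieSubmodule.coe_smul] at h
      conv_lhs => rw [h]
      rw [sum_lie]
      simp only [smul_lie]
      rfl
    have s2 : ∀ j, ⁅(b j : L), ⁅⁅x, (b' j : L)⁆, w⁆⁆
        = ∑ i, t ⁅x, (b' j : L)⁆ (b i : L) • ⁅(b j : L), ⁅(b' i : L), w⁆⁆ := by
      intro j
      have h := congrArg (fun u : J => (u : L)) (e2 ⟨⁅x, (b' j : L)⁆, J.lie_mem (b' j).2⟩)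
      simp only [AddSubmonoidClass.coe_finsetSum, LieSubmodule.coe_smul] at h
      conv_lhs => rw [h]
      rw [sum_lie, lie_sum]
      simp only [smul_lie, lie_smul]
      rfl
    symm
    rw [← sub_eq_zero, hCapp, hCapp, lie_sum, ← Finset.sum_sub_distrib]
    simp only [expand, s1, s2, Finset.sum_add_distrib]
    rw [Finset.sum_comm, ← Finset.sum_add_distrib]
    refine Finset.sum_eq_zero fun j _ => ?_
    rw [← Finset.sum_add_distrib]
    refine Finset.sum_eq_zero fun i _ => ?_
    rw [← add_smul]
    have : t ⁅x, (b i : L)⁆ (b' j : L) + t ⁅x, (b' j : L)⁆ (b i : L) = 0 := by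
      rw [ht, LieModule.traceForm_apply_lie_apply', LieModule.traceForm_comm K L W ⁅x, (b' j : L)⁆]
      simp
    rw [this, zero_smul]
  · simp only [C, map_sum]
    have : ∀ i, LinearMap.trace K W (φ (b i : L) * φ (b' i : L)) = 1 := by
      intro i
      have h := LinearMap.BilinForm.apply_dualBasis_right hB hBsymm b i i
      rw [if_pos rfl] at h
      exact h
    simp [this]
  · intro l hl
    ext w
    simp [hCapp, hl]

end WeylReducibility

section SemisimpleHom

variable {K U V : Type*} [Field K] [AddCommGroup U] [Module K U] [AddCommGroup V] [Module K V]

lemma aeval_compRight (f : Module.End K V) (p : Polynomial K) (φ : U →ₗ[K] V) :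
    Polynomial.aeval (LinearMap.compRight K f : Module.End K (U →ₗ[K] V)) p φ
      = (Polynomial.aeval f p) ∘ₗ φ := by
  induction p using Polynomial.induction_on' with
  | add p q hp hq => simp [hp, hq, LinearMap.add_comp]
  | monomial n a =>
    rw [Polynomial.aeval_monomial, Polynomial.aeval_monomial]
    have h : ∀ n : ℕ, ((LinearMap.compRight K f : Module.End K (U →ₗ[K] V)) ^ n) φ
        = (f ^ n) ∘ₗ φ := by
      intro n
      induction n with
      | zero => rfl
      | succ n ih => rw [pow_succ', pow_succ', Module.End.mul_apply, ih]; rfl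
    ext u
    simp [h]

lemma aeval_lcomp (f : Module.End K U) (p : Polynomial K) (φ : U →ₗ[K] V) :
    Polynomial.aeval (LinearMap.lcomp K V f : Module.End K (U →ₗ[K] V)) p φ
      = φ ∘ₗ (Polynomial.aeval f p) := by
  induction p using Polynomial.induction_on' with
  | add p q hp hq => simp [hp, hq, LinearMap.comp_add]
  | monomial n a =>
    rw [Polynomial.aeval_monomial, Polynomial.aeval_monomial]
    have h : ∀ n : ℕ, ((LinearMap.lcomp K V f : Module.End K (U →ₗ[K] V)) ^ n) φ
        = φ ∘ₗ (f ^ n) := by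
      intro n
      induction n with
      | zero => rfl
      | succ n ih => rw [pow_succ', pow_succ, Module.End.mul_apply, ih]; rfl
    ext u
    simp [h]

/-- If `f` and `g` are semisimple, so is `φ ↦ f ∘ φ - φ ∘ g`. -/
lemma isSemisimple_compRight_sub_lcomp [CharZero K] [FiniteDimensional K U] [FiniteDimensional K V]
    {f : Module.End K V} {g : Module.End K U} (hf : f.IsSemisimple) (hg : g.IsSemisimple) :
    (LinearMap.compRight K f - LinearMap.lcomp K V g : Module.End K (U →ₗ[K] V)).IsSemisimple := by
  refine Module.End.IsSemisimple.sub_of_commute ?_ ?_ ?_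
  · ext φ u; rfl
  · refine Module.End.isSemisimple_of_squarefree_aeval_eq_zero hf.minpoly_squarefree ?_
    refine LinearMap.ext fun φ => ?_
    rw [aeval_compRight, minpoly.aeval]; rfl
  · refine Module.End.isSemisimple_of_squarefree_aeval_eq_zero hg.minpoly_squarefree ?_
    refine LinearMap.ext fun φ => ?_
    rw [aeval_lcomp, minpoly.aeval, LinearMap.comp_zero]; rfl

end SemisimpleHom

section WeylReducibility

variable {K L W : Type*} [Field K] [LieRing L] [AddCommGroup W] [Module K W] [LieRingModule L W]

/-- The Fitting null component of a non-nilpotent equivariant endomorphism killed by `l` is a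
proper submodule on which `l` does not vanish. -/
lemma exists_lieSubmodule_of_not_isNilpotent [FiniteDimensional K W]
    (l : Dual K W) (hl : l ≠ 0) (C : Module.End K W)
    (hC : ∀ (x : L) (w : W), C ⁅x, w⁆ = ⁅x, C w⁆) (hlC : l ∘ₗ C = 0) (hn : ¬ IsNilpotent C) :
    ∃ U : LieSubmodule K L W, U.toSubmodule ≠ ⊤ ∧ ∃ u ∈ U, l u ≠ 0 := by
  obtain ⟨n, hn1, hc⟩ := ((Filter.eventually_ge_atTop 1).and
    C.eventually_isCompl_ker_pow_range_pow).exists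
  have hCn : ∀ (n : ℕ) (x : L) (w : W), (C ^ n) ⁅x, w⁆ = ⁅x, (C ^ n) w⁆ := by
    intro n x w
    induction n with
    | zero => rfl
    | succ n ih => rw [pow_succ', Module.End.mul_apply, ih, hC, Module.End.mul_apply]
  refine ⟨{ LinearMap.ker (C ^ n) with
    lie_mem := by
      intro x w hw
      change (C ^ n) ⁅x, w⁆ = 0
      rw [hCn, show (C ^ n) w = 0 from hw, lie_zero] }, ?_, ?_⟩
  · intro h
    exact hn ⟨n, LinearMap.ker_eq_top.mp h⟩
  · by_contra! h
    apply hl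
    ext w
    have hw : w ∈ LinearMap.ker (C ^ n) ⊔ LinearMap.range (C ^ n) := by
      rw [hc.sup_eq_top]; trivial
    obtain ⟨a, ha, _, ⟨b, rfl⟩, rfl⟩ := Submodule.mem_sup.mp hw
    obtain ⟨m, rfl⟩ : ∃ m, n = m + 1 := ⟨n - 1, by omega⟩
    rw [map_add, h a ha, pow_succ', Module.End.mul_apply, zero_add]
    exact LinearMap.congr_fun hlC _

variable [LieAlgebra K L] [LieModule K L W]

/-- Let all ideals of `L` be complemented and let the centre act semisimply on `W`. A nonzero
invariant functional on `W` is nonzero on some invariant vector. -/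
lemma exists_invariant_of_invariant_functional [CharZero K] [FiniteDimensional K L]
    (hL : ∀ I : LieIdeal K L, ∃ J : LieIdeal K L, IsCompl I J)
    [FiniteDimensional K W]
    (hZ : ∀ z ∈ LieAlgebra.center K L, (LieModule.toEnd K L W z).IsSemisimple)
    (l : Dual K W) (hl : l ≠ 0) (hinv : ∀ (x : L) (w : W), l ⁅x, w⁆ = 0) :
    ∃ w : W, l w ≠ 0 ∧ ∀ x : L, ⁅x, w⁆ = 0 := by
  induction hn : finrank K W using Nat.strong_induction_on generalizing W with
  | _ n ih =>
  have red : ∀ C : Module.End K W, (∀ (x : L) (w : W), C ⁅x, w⁆ = ⁅x, C w⁆) → l ∘ₗ C = 0 →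
      ¬ IsNilpotent C → ∃ w : W, l w ≠ 0 ∧ ∀ x : L, ⁅x, w⁆ = 0 := by
    intro C hC hlC hnil
    obtain ⟨U, hU, u, huU, hu⟩ := exists_lieSubmodule_of_not_isNilpotent l hl C hC hlC hnil
    obtain ⟨w, hw, hw'⟩ := ih (finrank K U.toSubmodule)
      (hn ▸ Submodule.finrank_lt hU) (W := U)
      (fun z hz => (hZ z hz).restrict (p := U.toSubmodule) (fun w hw => U.lie_mem hw))
      (l ∘ₗ U.toSubmodule.subtype) (fun h => hu (LinearMap.congr_fun h ⟨u, huU⟩))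
      (fun x w => hinv x w) rfl
    exact ⟨w, hw, fun x => congrArg Subtype.val (hw' x)⟩
  by_cases hz : ∀ z ∈ LieAlgebra.center K L, ∀ w : W, ⁅z, w⁆ = 0
  swap
  · push Not at hz
    obtain ⟨z, hz, w, hw⟩ := hz
    refine red (LieModule.toEnd K L W z) ?_ ?_ ?_
    · intro x w
      have h : ⁅x, z⁆ = 0 := hz x
      have h' := leibniz_lie x z w
      rw [h, zero_lie, zero_add] at h'
      exact h'.symm
    · ext w; exact hinv z w
    · intro h
      exact hw (LinearMap.congr_fun
        (Module.End.eq_zero_of_isNilpotent_isSemisimple h (hZ z hz)) w)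
  let N : LieIdeal K L :=
    { LinearMap.ker (LieModule.traceForm K L W) with
      lie_mem := by
        intro x m hm
        change LieModule.traceForm K L W ⁅x, m⁆ = 0
        ext y
        rw [LieModule.traceForm_apply_lie_apply',
          show LieModule.traceForm K L W m = 0 from hm]
        simp }
  have hNt := lie_eq_zero_of_mem_ker_traceForm hL hz N
    (fun x hx y => LinearMap.congr_fun (show LieModule.traceForm K L W x = 0 from hx) y)
  obtain ⟨J, hJ⟩ := hL N
  obtain ⟨C, hC, htr, hlC⟩ := exists_casimir N J hJ hNt (fun x hx h => by
    have : x ∈ N ⊓ J := ⟨LinearMap.ext h, hx⟩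
    rwa [hJ.inf_eq_bot, LieSubmodule.mem_bot] at this)
  by_cases hC0 : IsNilpotent C
  · have h0 : (finrank K J : K) = 0 := by
      rw [← htr]
      exact (LinearMap.isNilpotent_trace_of_isNilpotent hC0).eq_zero
    have h1 : finrank K J.toSubmodule = 0 := by exact_mod_cast h0
    have hJ0 : J = ⊥ := by
      rw [← LieSubmodule.toSubmodule_eq_bot]
      exact Submodule.finrank_eq_zero.mp h1
    have hNT : N = ⊤ := by simpa [hJ0] using hJ.sup_eq_top
    obtain ⟨w, hw⟩ : ∃ w, l w ≠ 0 := by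
      by_contra! h
      exact hl (LinearMap.ext h)
    exact ⟨w, hw, fun x => hNt x (by rw [hNT]; trivial) w⟩
  · exact red C hC (hlC l hinv) hC0

/-- Complete reducibility: let all ideals of `L` be complemented and let the centre act
semisimply on `W`. Then every submodule of `W` is complemented. -/
lemma exists_isCompl_lieSubmodule [CharZero K] [FiniteDimensional K L]
    (hL : ∀ I : LieIdeal K L, ∃ J : LieIdeal K L, IsCompl I J)
    [FiniteDimensional K W]
    (hZ : ∀ z ∈ LieAlgebra.center K L, (LieModule.toEnd K L W z).IsSemisimple)
    (U : LieSubmodule K L W) :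
    ∃ U' : LieSubmodule K L W, IsCompl U.toSubmodule U'.toSubmodule := by
  by_cases hU : U = ⊥
  · exact ⟨⊤, by simpa [hU] using isCompl_bot_top⟩
  have hU' : (finrank K U.toSubmodule : K) ≠ 0 := by
    rw [Nat.cast_ne_zero]
    intro h
    exact hU ((LieSubmodule.toSubmodule_eq_bot U).mp (Submodule.finrank_eq_zero.mp h))
  let E : LieSubmodule K L (W →ₗ[K] W) :=
    { carrier := {φ | (∀ w, φ w ∈ U) ∧ ∃ c : K, ∀ u ∈ U, φ u = c • u}
      add_mem' := by
        rintro φ ψ ⟨h1, c, h2⟩ ⟨h3, d, h4⟩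
        refine ⟨fun w => add_mem (h1 w) (h3 w), c + d, fun u hu => ?_⟩
        rw [LinearMap.add_apply, h2 u hu, h4 u hu, add_smul]
      zero_mem' := ⟨fun w => U.zero_mem, 0, fun u _ => by simp⟩
      smul_mem' := by
        rintro a φ ⟨h1, c, h2⟩
        refine ⟨fun w => U.smul_mem a (h1 w), a * c, fun u hu => ?_⟩
        rw [LinearMap.smul_apply, h2 u hu, mul_smul]
      lie_mem := by
        rintro x φ ⟨h1, c, h2⟩
        refine ⟨fun w => ?_, 0, fun u hu => ?_⟩
        · rw [LieHom.lie_apply]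
          exact sub_mem (U.lie_mem (h1 w)) (h1 _)
        · rw [LieHom.lie_apply, h2 u hu, h2 _ (U.lie_mem hu), lie_smul, sub_self, zero_smul] }
  obtain ⟨Q, hQ⟩ := Submodule.exists_isCompl U.toSubmodule
  let pr : W →ₗ[K] W := U.toSubmodule.subtype ∘ₗ U.toSubmodule.projectionOnto Q hQ
  have hpr : LinearMap.IsProj U.toSubmodule pr :=
    ⟨fun w => Subtype.property _, fun u hu => by
      simp [pr, Submodule.projectionOnto_apply_left hQ ⟨u, hu⟩]⟩
  have hprE : pr ∈ E := ⟨hpr.1, 1, fun u hu => by rw [hpr.2 u hu, one_smul]⟩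
  obtain ⟨⟨φ, hφ1, c, hφ2⟩, hφ3, hφ4⟩ := exists_invariant_of_invariant_functional (W := E) hL
    (fun z hz => Module.End.IsSemisimple.restrict (p := E.toSubmodule)
      (f := LieModule.toEnd K L (W →ₗ[K] W) z) (fun w hw => E.lie_mem hw)
      (isSemisimple_compRight_sub_lcomp (hZ z hz) (hZ z hz)))
    (LinearMap.trace K W ∘ₗ E.toSubmodule.subtype)
    (fun h => hU' (by
      rw [← hpr.trace]
      exact LinearMap.congr_fun h ⟨pr, hprE⟩))
    (fun x w => by
      change LinearMap.trace K W (LieModule.toEnd K L W x * (w : W →ₗ[K] W)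
        - (w : W →ₗ[K] W) * LieModule.toEnd K L W x) = 0
      rw [map_sub, LinearMap.trace_mul_comm, sub_self])
  have hinv : ∀ (x : L) (w : W), ⁅x, φ w⁆ = φ ⁅x, w⁆ := by
    intro x w
    have h := LinearMap.congr_fun (congrArg Subtype.val (hφ4 x)) w
    exact sub_eq_zero.mp h
  have hc : c ≠ 0 := by
    rintro rfl
    apply hφ3
    refine (LinearMap.isNilpotent_trace_of_isNilpotent (f := φ) ⟨2, ?_⟩).eq_zero
    ext w
    rw [pow_two, Module.End.mul_apply, hφ2 _ (hφ1 w)]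
    simp
  refine ⟨{ LinearMap.ker φ with
    lie_mem := by
      intro x w hw
      change φ ⁅x, w⁆ = 0
      rw [← hinv, show φ w = 0 from hw, lie_zero] }, ?_⟩
  refine IsCompl.of_eq ?_ ?_
  · rw [eq_bot_iff]
    rintro w ⟨hw1, hw2⟩
    have h := hφ2 w hw1
    rw [show φ w = 0 from hw2] at h
    exact (smul_eq_zero.mp h.symm).resolve_left hc
  · rw [eq_top_iff]
    intro w _
    refine Submodule.mem_sup.mpr ⟨c⁻¹ • φ w, U.smul_mem _ (hφ1 w), w - c⁻¹ • φ w, ?_, by simp⟩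
    change φ (w - c⁻¹ • φ w) = 0
    rw [map_sub, map_smul, hφ2 _ (hφ1 w), smul_smul, inv_mul_cancel₀ hc, one_smul, sub_self]

end WeylReducibility

lemma eq_zero_of_eq_neg {V : Type*} [AddCommGroup V] [Module ℂ V] {v : V} (h : v = -v) :
    v = 0 := by
  have : (2 : ℂ) • v = 0 := by rw [two_smul]; nth_rewrite 1 [h]; simp
  simpa using this

namespace SuperVS

variable (W : SuperVS)

lemma projEven_apply_of_mem {m : W.carrier} (hm : m ∈ W.part 0) : W.projEven m = m :=
  congrArg Subtype.val (Submodule.projectionOnto_apply_left W.isCompl ⟨m, hm⟩)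

lemma projEven_apply_of_mem_odd {m : W.carrier} (hm : m ∈ W.part 1) : W.projEven m = 0 :=
  congrArg Subtype.val (Submodule.projectionOnto_apply_right W.isCompl ⟨m, hm⟩)

lemma projOdd_apply_of_mem {m : W.carrier} (hm : m ∈ W.part 1) : W.projOdd m = m :=
  congrArg Subtype.val (Submodule.projectionOnto_apply_left W.isCompl.symm ⟨m, hm⟩)

lemma projOdd_apply_of_mem_even {m : W.carrier} (hm : m ∈ W.part 0) : W.projOdd m = 0 :=
  congrArg Subtype.val (Submodule.projectionOnto_apply_right W.isCompl.symm ⟨m, hm⟩)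

lemma exists_add_eq (m : W.carrier) : ∃ a ∈ W.part 0, ∃ b ∈ W.part 1, a + b = m := by
  have : m ∈ W.part 0 ⊔ W.part 1 := by rw [W.isCompl.sup_eq_top]; trivial
  exact Submodule.mem_sup.mp this

lemma pty_of_mem_even {m : W.carrier} (hm : m ∈ W.part 0) : W.pty m = m := by
  rw [pty, LinearMap.sub_apply, W.projEven_apply_of_mem hm, W.projOdd_apply_of_mem_even hm,
    sub_zero]

lemma pty_of_mem_odd {m : W.carrier} (hm : m ∈ W.part 1) : W.pty m = -m := by
  rw [pty, LinearMap.sub_apply, W.projOdd_apply_of_mem hm, W.projEven_apply_of_mem_odd hm,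
    zero_sub]

@[simp] lemma pty_pty (m : W.carrier) : W.pty (W.pty m) = m := by
  obtain ⟨a, ha, b, hb, rfl⟩ := W.exists_add_eq m
  simp [W.pty_of_mem_even ha, W.pty_of_mem_odd hb]

/-- The super vector space given by an involution: the even and odd parts are the eigenspaces for
the eigenvalues `1` and `-1`. -/
abbrev ofInvolution (V : Type) [AddCommGroup V] [Module ℂ V] (σ : V →ₗ[ℂ] V)
    (hσ : ∀ v, σ (σ v) = v) : SuperVS where
  carrier := V
  part i := if i = 0 then LinearMap.ker (σ - LinearMap.id) else LinearMap.ker (σ + LinearMap.id)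
  isCompl := by
    refine IsCompl.of_eq ?_ ?_
    · rw [eq_bot_iff]
      rintro v ⟨h1, h2⟩
      have h1' : σ v = v := sub_eq_zero.mp h1
      have h2' : σ v = -v := add_eq_zero_iff_eq_neg.mp h2
      exact eq_zero_of_eq_neg (h1'.symm.trans h2')
    · rw [eq_top_iff]
      intro v _
      refine Submodule.mem_sup.mpr ⟨(1 / 2 : ℂ) • (v + σ v), ?_, (1 / 2 : ℂ) • (v - σ v), ?_, ?_⟩
      · simp [hσ, add_comm]
      · simp [hσ]
      · module

lemma mem_ofInvolution_even {V : Type} [AddCommGroup V] [Module ℂ V] {σ : V →ₗ[ℂ] V}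
    {hσ : ∀ v, σ (σ v) = v} {v : V} : v ∈ (ofInvolution V σ hσ).part 0 ↔ σ v = v :=
  sub_eq_zero

lemma mem_ofInvolution_odd {V : Type} [AddCommGroup V] [Module ℂ V] {σ : V →ₗ[ℂ] V}
    {hσ : ∀ v, σ (σ v) = v} {v : V} : v ∈ (ofInvolution V σ hσ).part 1 ↔ σ v = -v :=
  add_eq_zero_iff_eq_neg

lemma pty_ofInvolution (V : Type) [AddCommGroup V] [Module ℂ V] (σ : V →ₗ[ℂ] V)
    (hσ : ∀ v, σ (σ v) = v) : (ofInvolution V σ hσ).pty = σ := by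
  refine LinearMap.ext fun v => ?_
  obtain ⟨a, ha, b, hb, rfl⟩ := (ofInvolution V σ hσ).exists_add_eq v
  rw [map_add, pty_of_mem_even _ ha, pty_of_mem_odd _ hb]
  have h := map_add σ a b
  exact ((congrArg₂ (fun u v : V => u + v) (mem_ofInvolution_even.mp ha)
    (mem_ofInvolution_odd.mp hb)).symm.trans h.symm)

end SuperVS

namespace LieSuperAlgebra

variable {g : LieSuperAlgebra}

lemma bracket_even_mem {x y : g.carrier} (hx : x ∈ g.part 0) (hy : y ∈ g.part 0) :
    g.bracket x y ∈ g.part 0 := g.bracket_grading 0 0 x hx y hy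

/-- The even part of a Lie superalgebra is a Lie algebra. -/
instance evenLieRing : LieRing (g.part 0) where
  bracket x y := ⟨g.bracket x y, bracket_even_mem x.2 y.2⟩
  add_lie x y z := Subtype.ext (by simp)
  lie_add x y z := Subtype.ext (by simp)
  lie_self x := Subtype.ext (by
    have h := g.bracket_skew 0 0 x x.2 x x.2
    simp only [ssgn, zero_ne_one, and_self, if_false, neg_smul, one_smul] at h
    exact eq_zero_of_eq_neg h)
  leibniz_lie x y z := Subtype.ext (by
    simpa [ssgn] using g.bracket_jacobi 0 0 0 x x.2 y y.2 z z.2)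

instance evenLieAlgebra : LieAlgebra ℂ (g.part 0) where
  lie_smul c x y := Subtype.ext (by
    change g.bracket x (c • (y : g.carrier)) = c • g.bracket x y
    simp)

namespace SuperModule

variable (M N : g.SuperModule)

instance evenLieRingModule : LieRingModule (g.part 0) M.carrier where
  bracket x m := M.act x m
  add_lie x y m := by
    change M.act ((x : g.carrier) + y) m = M.act x m + M.act y m
    simp
  lie_add x m n := map_add (M.act x) m n
  leibniz_lie x y m := by
    have h := M.act_bracket 0 0 x x.2 y y.2 m
    simp only [ssgn, zero_ne_one, and_self, if_false, one_smul] at h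
    change M.act x (M.act y m) = M.act (g.bracket x y) m + M.act y (M.act x m)
    rw [h, sub_add_cancel]

instance evenLieModule : LieModule ℂ (g.part 0) M.carrier where
  smul_lie c x m := by
    change M.act (c • (x : g.carrier)) m = c • M.act x m
    simp
  lie_smul c x m := map_smul (M.act x) c m

/-- The central elements of `g₀̄` act semisimply. -/
def CentreActsSemisimply : Prop :=
  ∀ z ∈ g.part 0, (∀ y ∈ g.part 0, g.bracket z y = 0) →
    Module.End.IsSemisimple (M.act z : Module.End ℂ M.carrier)

variable {M N}

lemma IsCompletelyReducibleEven.of_centreActsSemisimply (hg : g.IsClassical)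
    [FiniteDimensional ℂ M.carrier] (h : M.CentreActsSemisimply) :
    M.IsCompletelyReducibleEven := by
  have := hg.finiteDimensional
  intro U hU
  let U₁ : LieSubmodule ℂ (g.part 0) M.carrier :=
    { U with lie_mem := fun {x m} hm => hU x x.2 m hm }
  have hL : ∀ I : LieIdeal ℂ (g.part 0), ∃ J : LieIdeal ℂ (g.part 0), IsCompl I J := by
    intro I
    obtain ⟨V, hV, hV', h1, h2⟩ := hg.even_reducible (I.toSubmodule.map (g.part 0).subtype)
      (Submodule.map_subtype_le _ _) (by
        rintro x hx _ ⟨y, hy, rfl⟩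
        exact ⟨⁅(⟨x, hx⟩ : g.part 0), y⁆, I.lie_mem hy, rfl⟩)
    refine ⟨{ V.comap (g.part 0).subtype with
      lie_mem := fun {x m} hm => hV' x x.2 m hm }, IsCompl.of_eq ?_ ?_⟩
    · rw [eq_bot_iff]
      rintro x ⟨hx1, hx2⟩
      have : (x : g.carrier) ∈ I.toSubmodule.map (g.part 0).subtype ⊓ V := ⟨⟨x, hx1, rfl⟩, hx2⟩
      rw [h1] at this
      exact (LieSubmodule.mem_bot _).mpr (Subtype.ext this)
    · rw [eq_top_iff]
      rintro x -
      have hx : (x : g.carrier) ∈ I.toSubmodule.map (g.part 0).subtype ⊔ V := by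
        rw [h2]; exact x.2
      obtain ⟨_, ⟨a, ha, rfl⟩, b, hb, hab⟩ := Submodule.mem_sup.mp hx
      exact (LieSubmodule.mem_sup _ _ _).mpr ⟨a, ha, ⟨b, hV hb⟩, hb, Subtype.ext hab⟩
  obtain ⟨U', hU'⟩ := exists_isCompl_lieSubmodule hL (fun z hz => h z z.2 (fun y hy => by
    have h0 : ⁅(⟨y, hy⟩ : g.part 0), z⁆ = 0 := hz ⟨y, hy⟩
    rw [← lie_skew, neg_eq_zero] at h0
    exact congrArg Subtype.val h0)) U₁
  exact ⟨U'.toSubmodule, fun x hx m hm => U'.lie_mem (x := (⟨x, hx⟩ : g.part 0)) hm, hU'⟩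

lemma MemF.centreActsSemisimply (hM : M.MemF) : M.CentreActsSemisimply := by
  intro z hz hzc
  have := hM.1
  have hcomm : ∀ x ∈ g.part 0, ∀ m, M.act z (M.act x m) = M.act x (M.act z m) := by
    intro x hx m
    have h := M.act_bracket 0 0 z hz x hx m
    simp only [ssgn, zero_ne_one, and_self, if_false, one_smul, hzc x hx, map_zero,
      LinearMap.zero_apply] at h
    exact sub_eq_zero.mp h.symm
  set f : Module.End ℂ M.carrier := M.act z with hf
  have hst : M.IsEvenStable (⨆ μ, f.eigenspace μ) := by
    intro x hx m hm
    induction hm using Submodule.iSup_induction' with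
    | mem μ m hm =>
      refine Submodule.mem_iSup_of_mem μ ?_
      rw [Module.End.mem_eigenspace_iff] at hm ⊢
      rw [hcomm x hx, hm, map_smul]
    | zero => simp
    | add a b _ _ ha hb => rw [map_add]; exact add_mem ha hb
  obtain ⟨U', hU', hc⟩ := hM.2 _ hst
  have htop : ⨆ μ, f.eigenspace μ = ⊤ := by
    by_contra hne
    have hbot : U' ≠ ⊥ := by
      rintro rfl
      exact hne (by simpa using hc.sup_eq_top)
    have : Nontrivial U' := Submodule.nontrivial_iff_ne_bot.mpr hbot
    obtain ⟨μ, hμ⟩ := Module.End.exists_eigenvalue (f.restrict (p := U') (q := U')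
      (fun m hm => hU' z hz m hm))
    obtain ⟨v, hv⟩ := hμ.exists_hasEigenvector
    have h1 : f v = μ • (v : M.carrier) := congrArg Subtype.val hv.apply_eq_smul
    have h2 : (v : M.carrier) ∈ (⨆ μ, f.eigenspace μ) ⊓ U' :=
      ⟨Submodule.mem_iSup_of_mem μ (Module.End.mem_eigenspace_iff.mpr h1), v.2⟩
    rw [hc.inf_eq_bot] at h2
    exact hv.2 (Subtype.ext h2)
  let S := (minpoly ℂ f).roots.toFinset
  refine Module.End.isSemisimple_of_squarefree_aeval_eq_zero
    (p := ∏ μ ∈ S, (Polynomial.X - Polynomial.C μ))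
    (Polynomial.separable_prod_X_sub_C_iff'.mpr (fun _ _ _ _ h => h)).squarefree ?_
  ext m
  have hm : m ∈ ⨆ μ, f.eigenspace μ := by rw [htop]; trivial
  induction hm using Submodule.iSup_induction' with
  | mem μ m hm =>
    by_cases h0 : m = 0
    · simp [h0]
    have hev : f.HasEigenvector μ m := ⟨hm, h0⟩
    have hroot : (minpoly ℂ f).IsRoot μ :=
      Module.End.isRoot_of_hasEigenvalue (Module.End.hasEigenvalue_of_hasEigenvector hev)
    have hμ : μ ∈ S := Multiset.mem_toFinset.mpr
      ((Polynomial.mem_roots (minpoly.ne_zero (Algebra.IsIntegral.isIntegral f))).mpr hroot)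
    rw [Module.End.aeval_apply_of_hasEigenvector hev, Polynomial.eval_prod,
      Finset.prod_eq_zero hμ (by simp), zero_smul, LinearMap.zero_apply]
  | zero => simp
  | add a b _ _ ha hb => rw [map_add, ha, hb, map_add]

end SuperModule
end LieSuperAlgebra

namespace LieSuperAlgebra

variable {g : LieSuperAlgebra}

namespace SuperModule

section Parity

variable (M : g.SuperModule)

lemma pty_act_even {x : g.carrier} (hx : x ∈ g.part 0) (m : M.carrier) :
    M.pty (M.act x m) = M.act x (M.pty m) := by
  obtain ⟨a, ha, b, hb, rfl⟩ := M.exists_add_eq m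
  have h0 := M.act_grading 0 0 x hx a ha
  have h1 := M.act_grading 0 1 x hx b hb
  simp only [map_add, M.pty_of_mem_even ha, M.pty_of_mem_odd hb, map_neg,
    M.pty_of_mem_even (m := M.act x a) h0, M.pty_of_mem_odd (m := M.act x b) h1]

lemma pty_act_odd {x : g.carrier} (hx : x ∈ g.part 1) (m : M.carrier) :
    M.pty (M.act x m) = -M.act x (M.pty m) := by
  obtain ⟨a, ha, b, hb, rfl⟩ := M.exists_add_eq m
  have h0 := M.act_grading 1 0 x hx a ha
  have h1 := M.act_grading 1 1 x hx b hb
  simp only [map_add, M.pty_of_mem_even ha, M.pty_of_mem_odd hb, map_neg,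
    M.pty_of_mem_odd (m := M.act x a) h0, M.pty_of_mem_even (m := M.act x b) h1]
  abel

end Parity

lemma parity_cases (i : ZMod 2) : i = 0 ∨ i = 1 := by
  fin_cases i
  · exact Or.inl rfl
  · exact Or.inr rfl

/-- A supermodule given by a parity involution and an action. -/
abbrev ofInvolution (V : Type) [AddCommGroup V] [Module ℂ V] (σ : V →ₗ[ℂ] V)
    (hσ : ∀ v, σ (σ v) = v) (ρ : g.carrier →ₗ[ℂ] V →ₗ[ℂ] V)
    (h_even : ∀ x ∈ g.part 0, ∀ v, σ (ρ x v) = ρ x (σ v))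
    (h_odd : ∀ x ∈ g.part 1, ∀ v, σ (ρ x v) = -ρ x (σ v))
    (h_bracket : ∀ (i j : ZMod 2), ∀ x ∈ g.part i, ∀ y ∈ g.part j, ∀ v : V,
      ρ (g.bracket x y) v = ρ x (ρ y v) - ssgn i j • ρ y (ρ x v)) : g.SuperModule where
  toSuperVS := SuperVS.ofInvolution V σ hσ
  act := ρ
  act_grading := by
    intro i j x hx m hm
    rcases parity_cases i with rfl | rfl <;> rcases parity_cases j with rfl | rfl
    · rw [add_zero]
      rw [SuperVS.mem_ofInvolution_even] at hm ⊢
      rw [h_even x hx, hm]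
    · rw [zero_add]
      rw [SuperVS.mem_ofInvolution_odd] at hm ⊢
      rw [h_even x hx, hm, map_neg]
    · rw [add_zero]
      rw [SuperVS.mem_ofInvolution_odd]
      rw [SuperVS.mem_ofInvolution_even] at hm
      rw [h_odd x hx, hm]
    · rw [show (1 + 1 : ZMod 2) = 0 from rfl]
      rw [SuperVS.mem_ofInvolution_even]
      rw [SuperVS.mem_ofInvolution_odd] at hm
      rw [h_odd x hx, hm, map_neg, neg_neg]
  act_bracket := h_bracket

section Hom

variable (Y A : g.SuperModule)

/-- The parity involution on the space of linear maps. -/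
def homPty : (Y.carrier →ₗ[ℂ] A.carrier) →ₗ[ℂ] (Y.carrier →ₗ[ℂ] A.carrier) :=
  LinearMap.compRight ℂ A.pty ∘ₗ LinearMap.lcomp ℂ A.carrier Y.pty

/-- The action `x · φ = x ∘ φ - (-1)^{|x||φ|} φ ∘ x` on the space of linear maps. -/
def homAct : g.carrier →ₗ[ℂ] (Y.carrier →ₗ[ℂ] A.carrier) →ₗ[ℂ] (Y.carrier →ₗ[ℂ] A.carrier) :=
  LinearMap.mk₂ ℂ (fun x φ => A.act x ∘ₗ φ - φ ∘ₗ Y.act (g.projEven x)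
      - A.pty ∘ₗ φ ∘ₗ Y.pty ∘ₗ Y.act (g.projOdd x))
    (by intro x x' φ; ext y; simp; abel)
    (by intro c x φ; ext y; simp [smul_sub])
    (by intro x φ φ'; ext y; simp; abel)
    (by intro c x φ; ext y; simp [smul_sub])

variable {Y A}

lemma homPty_apply (φ : Y.carrier →ₗ[ℂ] A.carrier) (y : Y.carrier) :
    homPty Y A φ y = A.pty (φ (Y.pty y)) := rfl

lemma homPty_homPty (φ : Y.carrier →ₗ[ℂ] A.carrier) : homPty Y A (homPty Y A φ) = φ :=
  LinearMap.ext fun y => by simp [homPty_apply]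

lemma homAct_apply_even {x : g.carrier} (hx : x ∈ g.part 0) (φ : Y.carrier →ₗ[ℂ] A.carrier)
    (y : Y.carrier) : homAct Y A x φ y = A.act x (φ y) - φ (Y.act x y) := by
  simp [homAct, g.projEven_apply_of_mem hx, g.projOdd_apply_of_mem_even hx]

lemma homAct_apply_odd {x : g.carrier} (hx : x ∈ g.part 1) (φ : Y.carrier →ₗ[ℂ] A.carrier)
    (y : Y.carrier) :
    homAct Y A x φ y = A.act x (φ y) - A.pty (φ (Y.pty (Y.act x y))) := by
  simp [homAct, g.projEven_apply_of_mem_odd hx, g.projOdd_apply_of_mem hx]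

lemma homAct_bracket (i j : ZMod 2) (x : g.carrier) (hx : x ∈ g.part i) (y : g.carrier)
    (hy : y ∈ g.part j) (φ : Y.carrier →ₗ[ℂ] A.carrier) :
    homAct Y A (g.bracket x y) φ
      = homAct Y A x (homAct Y A y φ) - ssgn i j • homAct Y A y (homAct Y A x φ) := by
  have hxy := g.bracket_grading i j x hx y hy
  have hA := A.act_bracket i j x hx y hy
  have hY := Y.act_bracket i j x hx y hy
  ext v
  rcases parity_cases i with rfl | rfl <;> rcases parity_cases j with rfl | rfl
  · rw [LinearMap.sub_apply, LinearMap.smul_apply, homAct_apply_even hxy, homAct_apply_even hx,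
      homAct_apply_even hy, homAct_apply_even hy, homAct_apply_even hy, homAct_apply_even hx,
      homAct_apply_even hx, hA, hY]
    simp [ssgn]
    abel
  · rw [LinearMap.sub_apply, LinearMap.smul_apply, homAct_apply_odd (x := g.bracket x y) hxy,
      homAct_apply_even hx,
      homAct_apply_odd hy, homAct_apply_odd hy, homAct_apply_odd hy, homAct_apply_even hx,
      homAct_apply_even hx, hA, hY]
    simp [ssgn, A.pty_act_even hx, Y.pty_act_even hx]
    abel
  · rw [LinearMap.sub_apply, LinearMap.smul_apply, homAct_apply_odd (x := g.bracket x y) hxy,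
      homAct_apply_even hy, homAct_apply_odd hx, homAct_apply_odd hx, homAct_apply_odd hx,
      homAct_apply_even hy,
      homAct_apply_even hy, hA, hY]
    simp [ssgn, A.pty_act_even hy, Y.pty_act_even hy]
    abel
  · rw [LinearMap.sub_apply, LinearMap.smul_apply, homAct_apply_even (x := g.bracket x y) hxy,
      homAct_apply_odd hx,
      homAct_apply_odd hy, homAct_apply_odd hy, homAct_apply_odd hy, homAct_apply_odd hx,
      homAct_apply_odd hx, hA, hY]
    simp [ssgn, A.pty_act_odd hx, Y.pty_act_odd hx, A.pty_act_odd hy, Y.pty_act_odd hy]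
    abel

variable (Y A)

/-- The supermodule of all linear maps between two supermodules. -/
abbrev hom : g.SuperModule :=
  ofInvolution (Y.carrier →ₗ[ℂ] A.carrier) (homPty Y A)
    homPty_homPty (homAct Y A)
    (fun x hx φ => LinearMap.ext fun y => by
      rw [homPty_apply, homAct_apply_even hx, homAct_apply_even hx, homPty_apply, homPty_apply,
        map_sub, A.pty_act_even hx, Y.pty_act_even hx])
    (fun x hx φ => LinearMap.ext fun y => by
      rw [homPty_apply, LinearMap.neg_apply, homAct_apply_odd hx, homAct_apply_odd hx,
        homPty_apply, homPty_apply, map_sub, A.pty_act_odd hx, Y.pty_act_odd hx]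
      simp [Y.pty_act_odd hx, neg_add_eq_sub])
    homAct_bracket

variable {Y A}

lemma hom_pty : (hom Y A).pty = homPty Y A := SuperVS.pty_ofInvolution _ _ homPty_homPty

lemma MemF.hom (hg : g.IsClassical) (hY : Y.MemF) (hA : A.MemF) : (hom Y A).MemF := by
  have := hY.1
  have := hA.1
  have hfd : FiniteDimensional ℂ (SuperModule.hom Y A).carrier :=
    inferInstanceAs (FiniteDimensional ℂ (Y.carrier →ₗ[ℂ] A.carrier))
  refine ⟨hfd, .of_centreActsSemisimply hg fun z hz hzc => ?_⟩
  have h := isSemisimple_compRight_sub_lcomp (hA.centreActsSemisimply z hz hzc)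
    (hY.centreActsSemisimply z hz hzc)
  refine (congrArg Module.End.IsSemisimple ?_).mpr h
  exact LinearMap.ext fun φ => LinearMap.ext fun y => homAct_apply_even hz φ y

end Hom

/-- The trivial supermodule on a purely even space. -/
abbrev trivial (g : LieSuperAlgebra) (V : Type) [AddCommGroup V] [Module ℂ V] : g.SuperModule :=
  ofInvolution V LinearMap.id (fun _ => rfl) 0 (by simp) (by simp) (by simp)

lemma memF_trivial (V : Type) [AddCommGroup V] [Module ℂ V] [h : FiniteDimensional ℂ V] :
    (trivial g V).MemF := by
  refine ⟨h, fun U _ => ?_⟩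
  obtain ⟨U', hU'⟩ := Submodule.exists_isCompl U
  exact ⟨U', fun x _ m _ => U'.zero_mem, hU'⟩

lemma trivial_pty (V : Type) [AddCommGroup V] [Module ℂ V] :
    (trivial g V).pty = LinearMap.id :=
  SuperVS.pty_ofInvolution _ _ fun _ => rfl

section Sub

variable (M : g.SuperModule) (U : Submodule ℂ M.carrier) (hU : M.IsSubSuper U)

/-- A graded stable subspace as a supermodule. -/
abbrev sub : g.SuperModule :=
  ofInvolution U (M.pty.restrict hU.1) (fun v => Subtype.ext (M.pty_pty v))
    (LinearMap.mk₂ ℂ (fun x (u : U) => (⟨M.act x u, hU.2 x u u.2⟩ : U))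
      (fun x x' u => Subtype.ext (by simp)) (fun c x u => Subtype.ext (by simp))
      (fun x u u' => Subtype.ext (by simp)) (fun c x u => Subtype.ext (by simp)))
    (fun x hx u => Subtype.ext (M.pty_act_even hx u))
    (fun x hx u => Subtype.ext (M.pty_act_odd hx u))
    (fun i j x hx y hy u => Subtype.ext (M.act_bracket i j x hx y hy u))

variable {M U}

lemma MemF.sub (hg : g.IsClassical) (hM : M.MemF) : (sub M U hU).MemF := by
  have := hM.1
  have hfd : FiniteDimensional ℂ (SuperModule.sub M U hU).carrier :=
    inferInstanceAs (FiniteDimensional ℂ U)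
  refine ⟨hfd, .of_centreActsSemisimply hg fun z hz hzc => ?_⟩
  exact (hM.centreActsSemisimply z hz hzc).restrict (p := U) (fun m hm => hU.2 z m hm)

end Sub

/-- The supermodule with the opposite grading and the same action. -/
abbrev shift (M : g.SuperModule) : g.SuperModule where
  carrier := M.carrier
  part i := M.part (i + 1)
  isCompl := M.isCompl.symm
  act := M.act
  act_grading i j x hx m hm := by
    rw [add_assoc]
    exact M.act_grading i (j + 1) x hx m hm
  act_bracket := M.act_bracket

lemma shift_pty (M : g.SuperModule) (m : M.carrier) : M.shift.pty m = -M.pty m := by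
  obtain ⟨a, ha, b, hb, rfl⟩ := M.exists_add_eq m
  rw [map_add, map_add, M.shift.pty_of_mem_odd (m := a) ha, M.shift.pty_of_mem_even (m := b) hb,
    M.pty_of_mem_even ha, M.pty_of_mem_odd hb]
  abel

lemma MemF.shift {M : g.SuperModule} (hM : M.MemF) : M.shift.MemF := hM

section Double

variable (M : g.SuperModule)

/-- The action on `M × M` for which odd elements act with opposite signs on the two factors. -/
def doubleAct : g.carrier →ₗ[ℂ] (M.carrier × M.carrier) →ₗ[ℂ] (M.carrier × M.carrier) :=
  LinearMap.mk₂ ℂ (fun x m => (M.act x m.1, M.act (g.pty x) m.2))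
    (by intros; simp) (by intros; simp) (by intros; simp) (by intros; simp)

variable {M}

lemma doubleAct_apply (x : g.carrier) (m : M.carrier × M.carrier) :
    doubleAct M x m = (M.act x m.1, M.act (g.pty x) m.2) := rfl

lemma doubleAct_bracket (i j : ZMod 2) (x : g.carrier) (hx : x ∈ g.part i) (y : g.carrier)
    (hy : y ∈ g.part j) (m : M.carrier × M.carrier) :
    doubleAct M (g.bracket x y) m
      = doubleAct M x (doubleAct M y m) - ssgn i j • doubleAct M y (doubleAct M x m) := by
  have hxy := g.bracket_grading i j x hx y hy
  have h := M.act_bracket i j x hx y hy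
  simp only [doubleAct_apply, h]
  refine Prod.ext rfl ?_
  rcases parity_cases i with rfl | rfl <;> rcases parity_cases j with rfl | rfl
  · simp [g.pty_of_mem_even hx, g.pty_of_mem_even hy,
      g.pty_of_mem_even (m := g.bracket x y) hxy, h]
  · simp [g.pty_of_mem_even hx, g.pty_of_mem_odd hy,
      g.pty_of_mem_odd (m := g.bracket x y) hxy, h, ssgn]
    abel
  · simp [g.pty_of_mem_odd hx, g.pty_of_mem_even hy,
      g.pty_of_mem_odd (m := g.bracket x y) hxy, h, ssgn]
    abel
  · simp [g.pty_of_mem_odd hx, g.pty_of_mem_odd hy,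
      g.pty_of_mem_even (m := g.bracket x y) hxy, h]

variable (M)

/-- The supermodule `M × M` whose parity involution is the swap. -/
abbrev double : g.SuperModule :=
  ofInvolution (M.carrier × M.carrier) (LinearEquiv.prodComm ℂ M.carrier M.carrier).toLinearMap
    (fun _ => rfl) (doubleAct M)
    (fun x hx m => by simp [doubleAct_apply, g.pty_of_mem_even hx])
    (fun x hx m => by simp [doubleAct_apply, g.pty_of_mem_odd hx])
    doubleAct_bracket

lemma double_pty (m : M.carrier × M.carrier) : M.double.pty m = (m.2, m.1) := by
  rw [SuperVS.pty_ofInvolution _ _ fun _ => rfl]; rfl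

variable {M}

lemma MemF.double (hg : g.IsClassical) (hM : M.MemF) : M.double.MemF := by
  have := hM.1
  have hfd : FiniteDimensional ℂ M.double.carrier :=
    inferInstanceAs (FiniteDimensional ℂ (M.carrier × M.carrier))
  refine ⟨hfd, .of_centreActsSemisimply hg fun z hz hzc => ?_⟩
  have h := hM.centreActsSemisimply z hz hzc
  set f : Module.End ℂ M.carrier := M.act z
  have key : ∀ (p : Polynomial ℂ) (m : M.carrier × M.carrier),
      Polynomial.aeval (M.double.act z : Module.End ℂ (M.carrier × M.carrier)) p m
        = (Polynomial.aeval f p m.1, Polynomial.aeval f p m.2) := by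
    intro p m
    induction p using Polynomial.induction_on' with
    | add p q hp hq => simp [hp, hq]
    | monomial n a =>
      rw [Polynomial.aeval_monomial, Polynomial.aeval_monomial]
      have hpow : ∀ n : ℕ, ((M.double.act z : Module.End ℂ (M.carrier × M.carrier)) ^ n) m
          = ((f ^ n) m.1, (f ^ n) m.2) := by
        intro n
        induction n with
        | zero => rfl
        | succ n ih =>
          rw [pow_succ', pow_succ', Module.End.mul_apply, ih]
          exact (doubleAct_apply z _).trans (by rw [g.pty_of_mem_even hz]; rfl)
      simp [hpow]
  refine Module.End.isSemisimple_of_squarefree_aeval_eq_zero h.minpoly_squarefree ?_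
  refine LinearMap.ext fun m => (key _ m).trans ?_
  rw [minpoly.aeval]; rfl

end Double

end SuperModule
end LieSuperAlgebra

namespace LieSuperAlgebra

variable {g : LieSuperAlgebra}

namespace SuperModule

variable {M N : g.SuperModule}

/-- A linear map commuting with the action, without signs. -/
def IsIntertwiner (M N : g.SuperModule) (f : M.carrier →ₗ[ℂ] N.carrier) : Prop :=
  ∀ (x : g.carrier) (m : M.carrier), f (M.act x m) = N.act x (f m)

/-- A linear map preserving the grading. -/
def IsEvenMap (M N : g.SuperModule) (f : M.carrier →ₗ[ℂ] N.carrier) : Prop :=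
  ∀ m : M.carrier, f (M.pty m) = N.pty (f m)

lemma IsIntertwiner.of_homogeneous {f : M.carrier →ₗ[ℂ] N.carrier}
    (h0 : ∀ x ∈ g.part 0, ∀ m, f (M.act x m) = N.act x (f m))
    (h1 : ∀ x ∈ g.part 1, ∀ m, f (M.act x m) = N.act x (f m)) : IsIntertwiner M N f := by
  intro x m
  obtain ⟨a, ha, b, hb, rfl⟩ := g.exists_add_eq x
  simp [h0 a ha, h1 b hb]

lemma IsIntertwiner.comp {N' : g.SuperModule} {f : M.carrier →ₗ[ℂ] N.carrier}
    {f' : N.carrier →ₗ[ℂ] N'.carrier} (hf' : IsIntertwiner N N' f') (hf : IsIntertwiner M N f) :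
    IsIntertwiner M N' (f' ∘ₗ f) := fun x m => by
  rw [LinearMap.comp_apply, hf, hf', LinearMap.comp_apply]

lemma isIntertwiner_id : IsIntertwiner M M LinearMap.id := fun _ _ => rfl

lemma IsIntertwiner.add {f f' : M.carrier →ₗ[ℂ] N.carrier}
    (hf : IsIntertwiner M N f) (hf' : IsIntertwiner M N f') : IsIntertwiner M N (f + f') :=
  fun x m => by simp [hf x m, hf' x m]

lemma IsIntertwiner.sub {f f' : M.carrier →ₗ[ℂ] N.carrier}
    (hf : IsIntertwiner M N f) (hf' : IsIntertwiner M N f') : IsIntertwiner M N (f - f') :=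
  fun x m => by simp [hf x m, hf' x m]

lemma IsIntertwiner.smul {f : M.carrier →ₗ[ℂ] N.carrier} (c : ℂ)
    (hf : IsIntertwiner M N f) : IsIntertwiner M N (c • f) :=
  fun x m => by simp [hf x m]

lemma IsIntertwiner.pty_conj {f : M.carrier →ₗ[ℂ] N.carrier} (hf : IsIntertwiner M N f) :
    IsIntertwiner M N (N.pty ∘ₗ f ∘ₗ M.pty) :=
  .of_homogeneous (fun x hx m => by simp [M.pty_act_even hx, N.pty_act_even hx, hf x])
    (fun x hx m => by simp [M.pty_act_odd hx, N.pty_act_odd hx, hf x])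

/-- Lifting of intertwiners along surjective intertwiners in `F`. -/
def HasLifting (P : g.SuperModule) : Prop :=
  ∀ (M N : g.SuperModule), M.MemF → N.MemF → ∀ p : M.carrier →ₗ[ℂ] N.carrier,
    IsIntertwiner M N p → Function.Surjective p →
    ∀ f : P.carrier →ₗ[ℂ] N.carrier, IsIntertwiner P N f →
      ∃ h : P.carrier →ₗ[ℂ] M.carrier, IsIntertwiner P M h ∧ p ∘ₗ h = f

section Twist

variable (M)

/-- The operator `1 + iσ`; conjugation by it exchanges supermodule homomorphisms and
intertwiners. -/
def twist : M.carrier →ₗ[ℂ] M.carrier := LinearMap.id + Complex.I • M.pty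

/-- The inverse of `twist`. -/
def untwist : M.carrier →ₗ[ℂ] M.carrier := (1 / 2 : ℂ) • (LinearMap.id - Complex.I • M.pty)

@[simp] lemma twist_untwist (m : M.carrier) : M.twist (M.untwist m) = m := by
  simp only [twist, untwist, LinearMap.add_apply, LinearMap.smul_apply, LinearMap.sub_apply,
    LinearMap.id_apply, map_smul, map_sub, SuperVS.pty_pty]
  match_scalars
  · linear_combination (-1 / 2 : ℂ) * Complex.I_sq
  · ring

@[simp] lemma untwist_twist (m : M.carrier) : M.untwist (M.twist m) = m := by
  simp only [twist, untwist, LinearMap.add_apply, LinearMap.smul_apply, LinearMap.sub_apply,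
    LinearMap.id_apply, map_smul, map_add, SuperVS.pty_pty]
  match_scalars
  · linear_combination (-1 / 2 : ℂ) * Complex.I_sq
  · ring

variable {M}

lemma isIntertwiner_of_superHom (f : g.SuperHom M N) :
    IsIntertwiner M N (N.twist ∘ₗ f.toLinearMap ∘ₗ M.untwist) := by
  refine .of_homogeneous (fun x hx m => ?_) (fun x hx m => ?_)
  · have h := f.compat 0 x hx
    simp only [SuperVS.ptyPow, if_true, LinearMap.id_apply] at h
    simp [twist, untwist, M.pty_act_even hx, N.pty_act_even hx, h]
  · have h := f.compat 1 x hx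
    simp only [SuperVS.ptyPow, one_ne_zero, if_false] at h
    simp only [twist, untwist, M.pty_act_odd hx, N.pty_act_odd hx, h, LinearMap.comp_apply,
      LinearMap.add_apply, LinearMap.smul_apply, LinearMap.sub_apply,
      LinearMap.id_apply, map_smul, map_sub, map_add, SuperVS.pty_pty, map_neg]
    match_scalars <;> ring_nf <;> norm_num [Complex.I_sq]

/-- The supermodule homomorphism attached to an intertwiner. -/
def superHomOfIntertwiner (f : M.carrier →ₗ[ℂ] N.carrier) (hf : IsIntertwiner M N f) :
    g.SuperHom M N where
  toLinearMap := N.untwist ∘ₗ f ∘ₗ M.twist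
  compat := by
    intro i x hx m
    rcases parity_cases i with rfl | rfl
    · simp [SuperVS.ptyPow, twist, untwist, M.pty_act_even hx, N.pty_act_even hx, hf x]
    · simp only [SuperVS.ptyPow, one_ne_zero, if_false, twist, untwist, M.pty_act_odd hx,
        N.pty_act_odd hx, hf x, LinearMap.comp_apply,
        LinearMap.add_apply, LinearMap.smul_apply, LinearMap.sub_apply,
        LinearMap.id_apply, map_smul, map_sub, map_add, SuperVS.pty_pty, map_neg]
      match_scalars <;> ring_nf <;> norm_num [Complex.I_sq]

lemma isProjectiveInF_iff {P : g.SuperModule} :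
    g.IsProjectiveInF P ↔ P.MemF ∧ P.HasLifting := by
  refine and_congr_right fun _ => ⟨fun H M N hM hN p hp hps f hf => ?_,
    fun H M N hM hN p hps f => ?_⟩
  · obtain ⟨h, hh⟩ := H M N hM hN (superHomOfIntertwiner p hp) (fun n => by
      obtain ⟨m, hm⟩ := hps (N.twist n)
      exact ⟨M.untwist m, by simp [superHomOfIntertwiner, hm]⟩) (superHomOfIntertwiner f hf)
    refine ⟨_, isIntertwiner_of_superHom h, LinearMap.ext fun v => ?_⟩
    have h1 := congrArg N.twist (LinearMap.congr_fun hh (P.untwist v))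
    simpa [superHomOfIntertwiner] using h1
  · obtain ⟨h, hh, hh'⟩ := H M N hM hN _ (isIntertwiner_of_superHom p) (fun n => by
      obtain ⟨m, hm⟩ := hps (N.untwist n)
      exact ⟨M.twist m, by simp [hm]⟩) _ (isIntertwiner_of_superHom f)
    refine ⟨superHomOfIntertwiner h hh, LinearMap.ext fun v => ?_⟩
    have h1 := congrArg N.untwist (LinearMap.congr_fun hh' (P.twist v))
    simpa [superHomOfIntertwiner] using h1

end Twist

section Functoriality

variable {X Y A B D : g.SuperModule}

lemma IsIntertwiner.hom_lcomp {d : X.carrier →ₗ[ℂ] Y.carrier} (hd : IsIntertwiner X Y d)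
    (hd' : IsEvenMap X Y d) :
    IsIntertwiner (hom Y A) (hom X A) (LinearMap.lcomp ℂ A.carrier d) :=
  .of_homogeneous
    (fun x hx φ => LinearMap.ext fun m => by
      refine (homAct_apply_even hx φ (d m)).trans (Eq.trans ?_ (homAct_apply_even hx _ m).symm)
      simp [hd x])
    (fun x hx φ => LinearMap.ext fun m => by
      refine (homAct_apply_odd hx φ (d m)).trans (Eq.trans ?_ (homAct_apply_odd hx _ m).symm)
      simp [hd x, hd' _])

lemma IsEvenMap.hom_lcomp {d : X.carrier →ₗ[ℂ] Y.carrier} (hd' : IsEvenMap X Y d) :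
    IsEvenMap (hom Y A) (hom X A) (LinearMap.lcomp ℂ A.carrier d) := by
  intro φ
  rw [hom_pty, hom_pty]
  refine LinearMap.ext fun m => ?_
  change A.pty (φ (Y.pty (d m))) = A.pty (φ (d (X.pty m)))
  rw [hd']

lemma IsIntertwiner.hom_compRight {q : A.carrier →ₗ[ℂ] B.carrier} (hq : IsIntertwiner A B q)
    (hq' : IsEvenMap A B q) :
    IsIntertwiner (hom D A) (hom D B) (LinearMap.compRight ℂ q) :=
  .of_homogeneous
    (fun x hx φ => LinearMap.ext fun m => by
      refine (congrArg q (homAct_apply_even hx φ m)).trans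
        (Eq.trans ?_ (homAct_apply_even hx _ m).symm)
      simp [hq x])
    (fun x hx φ => LinearMap.ext fun m => by
      refine (congrArg q (homAct_apply_odd hx φ m)).trans
        (Eq.trans ?_ (homAct_apply_odd hx _ m).symm)
      simp [hq x, hq' _])

lemma IsEvenMap.hom_compRight {q : A.carrier →ₗ[ℂ] B.carrier} (hq' : IsEvenMap A B q) :
    IsEvenMap (hom D A) (hom D B) (LinearMap.compRight ℂ q) := by
  intro φ
  rw [hom_pty, hom_pty]
  exact LinearMap.ext fun m => hq' _

end Functoriality

lemma isSubSuper_range {p : M.carrier →ₗ[ℂ] N.carrier} (hp : IsIntertwiner M N p)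
    (hp' : IsEvenMap M N p) : N.IsSubSuper (LinearMap.range p) := by
  constructor
  · rintro _ ⟨m, rfl⟩; exact ⟨M.pty m, hp' m⟩
  · rintro x _ ⟨m, rfl⟩; exact ⟨M.act x m, hp x m⟩

/-- An even map into the range of an even intertwiner lifts to an even map. -/
lemma HasLifting.exists_even_lift {P : g.SuperModule} (hP : P.HasLifting) (hg : g.IsClassical)
    (hM : M.MemF) (hN : N.MemF) {p : M.carrier →ₗ[ℂ] N.carrier} (hp : IsIntertwiner M N p)
    (hp' : IsEvenMap M N p) {f : P.carrier →ₗ[ℂ] N.carrier} (hf : IsIntertwiner P N f)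
    (hf' : IsEvenMap P N f) (hfp : ∀ v, f v ∈ LinearMap.range p) :
    ∃ h : P.carrier →ₗ[ℂ] M.carrier, IsIntertwiner P M h ∧ IsEvenMap P M h ∧ p ∘ₗ h = f := by
  have hS := isSubSuper_range hp hp'
  obtain ⟨h, hh, hph⟩ := hP M (sub N _ hS) hM (hN.sub hS hg) p.rangeRestrict
    (fun x m => Subtype.ext (hp x m)) p.surjective_rangeRestrict (f.codRestrict _ hfp)
    (fun x m => Subtype.ext (hf x m))
  have hph' : ∀ v, p (h v) = f v := fun v => congrArg Subtype.val (LinearMap.congr_fun hph v)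
  refine ⟨(1 / 2 : ℂ) • (h + M.pty ∘ₗ h ∘ₗ P.pty), (hh.add hh.pty_conj).smul _, fun v => ?_,
    LinearMap.ext fun v => ?_⟩
  · simp [add_comm]
  · simp only [LinearMap.comp_apply, LinearMap.smul_apply, LinearMap.add_apply, map_smul, map_add,
      hp' _, hph', hf' _, SuperVS.pty_pty]
    module

lemma sum_basis_coord_comp {V H : Type*} [AddCommGroup V] [Module ℂ V] [AddCommGroup H]
    [Module ℂ H] {ι : Type*} [Fintype ι] (b : Basis ι ℂ V)
    (F : V →ₗ[ℂ] (V →ₗ[ℂ] ℂ) →ₗ[ℂ] H) (B : V →ₗ[ℂ] V) :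
    ∑ i, F (B (b i)) (b.coord i) = ∑ i, F (b i) (b.coord i ∘ₗ B) := by
  classical
  have h1 : ∀ i, F (B (b i)) (b.coord i)
      = ∑ j, b.coord j (B (b i)) • F (b j) (b.coord i) := by
    intro i
    conv_lhs => rw [← b.sum_repr (B (b i))]
    simp only [map_sum, map_smul, LinearMap.sum_apply, LinearMap.smul_apply, Basis.coord_apply]
  have h2 : ∀ j, F (b j) (b.coord j ∘ₗ B)
      = ∑ i, b.coord j (B (b i)) • F (b j) (b.coord i) := by
    intro j
    have : b.coord j ∘ₗ B = ∑ i, b.coord j (B (b i)) • b.coord i := by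
      refine b.ext fun k => ?_
      simp [LinearMap.sum_apply, Finsupp.single_apply]
    rw [this]
    simp
  simp only [h1, h2]
  exact Finset.sum_comm

section Contraction

variable {P H : g.SuperModule} {ι : Type*} [Fintype ι] (b : Basis ι ℂ P.carrier)
  {T : P.carrier →ₗ[ℂ] (P.carrier →ₗ[ℂ] ℂ) →ₗ[ℂ] H.carrier}

lemma dual_act_even {x : g.carrier} (hx : x ∈ g.part 0) (ξ : P.carrier →ₗ[ℂ] ℂ) :
    homAct P (trivial g ℂ) x ξ = -(ξ ∘ₗ P.act x) := by
  refine LinearMap.ext fun v => (homAct_apply_even (A := trivial g ℂ) hx ξ v).trans ?_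
  change (0 : ℂ) - ξ (P.act x v) = -ξ (P.act x v)
  rw [zero_sub]

lemma dual_act_odd {x : g.carrier} (hx : x ∈ g.part 1) (ξ : P.carrier →ₗ[ℂ] ℂ) :
    homAct P (trivial g ℂ) x ξ = -(ξ ∘ₗ P.pty ∘ₗ P.act x) := by
  refine LinearMap.ext fun v => (homAct_apply_odd (A := trivial g ℂ) hx ξ v).trans ?_
  rw [trivial_pty]
  change (0 : ℂ) - ξ (P.pty (P.act x v)) = -ξ (P.pty (P.act x v))
  rw [zero_sub]

lemma dual_pty (ξ : P.carrier →ₗ[ℂ] ℂ) : homPty P (trivial g ℂ) ξ = ξ ∘ₗ P.pty := by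
  refine LinearMap.ext fun v => (homPty_apply _ _).trans ?_
  rw [trivial_pty]; rfl

lemma IsEvenMap.apply_pty_dual (hTe : IsEvenMap P (hom (hom P (trivial g ℂ)) H) T)
    (v : P.carrier) (ξ : P.carrier →ₗ[ℂ] ℂ) : T (P.pty v) ξ = H.pty (T v (ξ ∘ₗ P.pty)) := by
  have h := LinearMap.congr_fun (hTe v) ξ
  rw [hom_pty] at h
  refine h.trans ((homPty_apply (Y := hom P (trivial g ℂ)) _ _).trans ?_)
  rw [hom_pty, dual_pty]

/-- The contraction of an even intertwiner is even. -/
lemma pty_contraction (hTe : IsEvenMap P (hom (hom P (trivial g ℂ)) H) T) :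
    H.pty (∑ i, T (b i) (b.coord i)) = ∑ i, T (b i) (b.coord i) := by
  have h2 : ∀ i, H.pty (T (b i) (b.coord i)) = T (P.pty (b i)) (b.coord i ∘ₗ P.pty) := by
    intro i
    rw [hTe.apply_pty_dual]
    congr 2
    exact LinearMap.ext fun v => by simp
  rw [map_sum]
  simp only [h2]
  refine (sum_basis_coord_comp b (T ∘ₗ P.pty) P.pty).symm.trans ?_
  simp

/-- The contraction of an even intertwiner is invariant. -/
lemma act_contraction (hT : IsIntertwiner P (hom (hom P (trivial g ℂ)) H) T)
    (hTe : IsEvenMap P (hom (hom P (trivial g ℂ)) H) T) (x : g.carrier) :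
    H.act x (∑ i, T (b i) (b.coord i)) = 0 := by
  have heven : ∀ x ∈ g.part 0, ∀ v ξ,
      H.act x (T v ξ) = T (P.act x v) ξ - T v (ξ ∘ₗ P.act x) := by
    intro x hx v ξ
    have h := LinearMap.congr_fun (hT x v) ξ
    have h' := h.trans (homAct_apply_even (Y := hom P (trivial g ℂ)) hx _ ξ)
    have h'' : T (P.act x v) ξ = H.act x (T v ξ) - T v (homAct P (trivial g ℂ) x ξ) := h'
    rw [h'', dual_act_even hx]
    simp
  have hodd : ∀ x ∈ g.part 1, ∀ v ξ,
      H.act x (T v ξ) = T (P.act x v) ξ - T (P.pty v) (ξ ∘ₗ P.pty ∘ₗ P.act x) := by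
    intro x hx v ξ
    have h := LinearMap.congr_fun (hT x v) ξ
    have h' := h.trans (homAct_apply_odd (Y := hom P (trivial g ℂ)) hx _ ξ)
    rw [hom_pty] at h'
    have h'' : T (P.act x v) ξ = H.act x (T v ξ)
      - H.pty (T v (homPty P (trivial g ℂ) (homAct P (trivial g ℂ) x ξ))) := h'
    rw [h'', dual_act_odd hx, dual_pty, hTe.apply_pty_dual]
    simp [LinearMap.neg_comp]
  obtain ⟨y, hy, z, hz, rfl⟩ := g.exists_add_eq x
  have h1 : H.act y (∑ i, T (b i) (b.coord i)) = 0 := by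
    rw [map_sum]
    simp only [heven y hy, Finset.sum_sub_distrib]
    rw [sum_basis_coord_comp b T (P.act y), sub_self]
  have h2 : H.act z (∑ i, T (b i) (b.coord i)) = 0 := by
    rw [map_sum]
    simp only [hodd z hz, Finset.sum_sub_distrib]
    have := sum_basis_coord_comp b (T ∘ₗ P.pty) (P.pty ∘ₗ P.act z)
    simp only [LinearMap.comp_apply, SuperVS.pty_pty] at this
    rw [← this, sub_self]
  rw [map_add, LinearMap.add_apply, h1, h2, add_zero]

end Contraction

end SuperModule
end LieSuperAlgebra

namespace LieSuperAlgebra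

variable {g : LieSuperAlgebra}

namespace SuperModule

variable {P X Y : g.SuperModule}

section RankOne

/-- The map `v ↦ (ξ ↦ (n ↦ ξ (e n) • v))`. -/
def rankOneMap {P X : Type*} [AddCommGroup P] [Module ℂ P] [AddCommGroup X] [Module ℂ X]
    (e : X →ₗ[ℂ] P) : P →ₗ[ℂ] (P →ₗ[ℂ] ℂ) →ₗ[ℂ] (X →ₗ[ℂ] P) :=
  LinearMap.mk₂ ℂ (fun v ξ => (ξ ∘ₗ e).smulRight v)
    (by intros; ext; simp) (by intros; ext; simp [smul_smul, mul_comm])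
    (by intros; ext; simp [add_smul]) (by intros; ext; simp [smul_smul])

lemma rankOneMap_apply {P X : Type*} [AddCommGroup P] [Module ℂ P] [AddCommGroup X] [Module ℂ X]
    (e : X →ₗ[ℂ] P) (v : P) (ξ : P →ₗ[ℂ] ℂ) (n : X) : rankOneMap e v ξ n = ξ (e n) • v := rfl

lemma isEvenMap_rankOneMap {e : X.carrier →ₗ[ℂ] P.carrier} (he' : IsEvenMap X P e) :
    IsEvenMap P (hom (hom P (trivial g ℂ)) (hom X P)) (rankOneMap e) := by
  intro v
  rw [hom_pty]
  refine LinearMap.ext fun ξ => LinearMap.ext fun n => ?_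
  refine Eq.trans ?_ (LinearMap.congr_fun
    (homPty_apply (Y := hom P (trivial g ℂ)) (A := hom X P) _ ξ) n).symm
  rw [hom_pty, hom_pty, dual_pty]
  refine Eq.trans ?_ (homPty_apply (Y := X) (A := P) _ n).symm
  rw [rankOneMap_apply, rankOneMap_apply]
  simp [he' _]

lemma isIntertwiner_rankOneMap {e : X.carrier →ₗ[ℂ] P.carrier} (he : IsIntertwiner X P e)
    (he' : IsEvenMap X P e) :
    IsIntertwiner P (hom (hom P (trivial g ℂ)) (hom X P)) (rankOneMap e) := by
  refine .of_homogeneous (fun x hx v => ?_) (fun x hx v => ?_)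
  · refine LinearMap.ext fun ξ => LinearMap.ext fun n => ?_
    refine Eq.trans ?_ (LinearMap.congr_fun
      (homAct_apply_even (Y := hom P (trivial g ℂ)) (A := hom X P) hx _ ξ) n).symm
    refine Eq.trans ?_ (congrArg₂ (fun a b : P.carrier => a - b)
      (homAct_apply_even (Y := X) (A := P) hx (rankOneMap e v ξ) n)
      (LinearMap.congr_fun (congrArg (rankOneMap e v) (dual_act_even hx ξ)) n)).symm
    simp [rankOneMap_apply, he x]
  · refine LinearMap.ext fun ξ => LinearMap.ext fun n => ?_
    refine Eq.trans ?_ (LinearMap.congr_fun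
      (homAct_apply_odd (Y := hom P (trivial g ℂ)) (A := hom X P) hx _ ξ) n).symm
    rw [hom_pty, hom_pty]
    refine Eq.trans ?_ (congrArg₂ (fun a b : P.carrier => a - b)
      (homAct_apply_odd (Y := X) (A := P) hx (rankOneMap e v ξ) n)
      ((homPty_apply (Y := X) (A := P) _ n).trans (congrArg (fun η => P.pty (rankOneMap e v η
        (X.pty n))) ((congrArg _ (dual_act_odd hx ξ)).trans (dual_pty _))))).symm
    simp [rankOneMap_apply, he x, he' _]

end RankOne

lemma exists_comp_eq_of_ker_le {V W Z : Type*} [AddCommGroup V] [Module ℂ V] [AddCommGroup W]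
    [Module ℂ W] [AddCommGroup Z] [Module ℂ Z] {d : V →ₗ[ℂ] W} {e : V →ₗ[ℂ] Z}
    (h : LinearMap.ker d ≤ LinearMap.ker e) : ∃ f : W →ₗ[ℂ] Z, f ∘ₗ d = e := by
  obtain ⟨r, hr⟩ := d.rangeRestrict.exists_rightInverse_of_surjective d.range_rangeRestrict
  obtain ⟨f, hf⟩ := LinearMap.exists_extend (e ∘ₗ r)
  refine ⟨f, LinearMap.ext fun v => ?_⟩
  have h1 : f (d v) = e (r (d.rangeRestrict v)) := LinearMap.congr_fun hf (d.rangeRestrict v)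
  have h2 : d (r (d.rangeRestrict v)) = d v :=
    congrArg Subtype.val (LinearMap.congr_fun hr (d.rangeRestrict v))
  have h3 : r (d.rangeRestrict v) - v ∈ LinearMap.ker e := h (by simp [h2])
  rw [LinearMap.comp_apply, h1]
  simpa [sub_eq_zero] using h3

/-- Extension of even intertwiners into `P` along even intertwiners. -/
lemma HasLifting.exists_extension_of_even (hg : g.IsClassical) (hPF : P.MemF) (hP : P.HasLifting)
    (hX : X.MemF) (hY : Y.MemF) {d : X.carrier →ₗ[ℂ] Y.carrier} (hd : IsIntertwiner X Y d)
    (hd' : IsEvenMap X Y d) {e : X.carrier →ₗ[ℂ] P.carrier} (he : IsIntertwiner X P e)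
    (he' : IsEvenMap X P e) (hde : LinearMap.ker d ≤ LinearMap.ker e) :
    ∃ s : Y.carrier →ₗ[ℂ] P.carrier, IsIntertwiner Y P s ∧ s ∘ₗ d = e := by
  have := hPF.1
  let D : g.SuperModule := hom P (trivial g ℂ)
  have hD : D.MemF := hPF.hom hg (memF_trivial ℂ)
  obtain ⟨e₁, he₁⟩ := exists_comp_eq_of_ker_le hde
  obtain ⟨T, hT, hTe, hpT⟩ := hP.exists_even_lift (M := hom D (hom Y P)) (N := hom D (hom X P)) hg
    (hD.hom hg (hY.hom hg hPF)) (hD.hom hg (hX.hom hg hPF))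
    (p := LinearMap.compRight ℂ (LinearMap.lcomp ℂ P.carrier d))
    (IsIntertwiner.hom_compRight (hd.hom_lcomp hd') hd'.hom_lcomp)
    (IsEvenMap.hom_compRight hd'.hom_lcomp)
    (f := rankOneMap e) (isIntertwiner_rankOneMap he he') (isEvenMap_rankOneMap he')
    (fun v => ⟨rankOneMap e₁ v, by
      rw [← he₁]; rfl⟩)
  let b := Module.finBasis ℂ P.carrier
  let T' : P.carrier →ₗ[ℂ] (P.carrier →ₗ[ℂ] ℂ) →ₗ[ℂ] (hom Y P).carrier := T
  let s : Y.carrier →ₗ[ℂ] P.carrier := ∑ i, T' (b i) (b.coord i)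
  have hs : ∀ x, homAct Y P x s = 0 := act_contraction b hT hTe
  have hs' : homPty Y P s = s := by
    have h := pty_contraction (H := hom Y P) (T := T') b hTe
    rw [hom_pty] at h
    exact h
  refine ⟨s, .of_homogeneous (fun x hx y => ?_) (fun x hx y => ?_), LinearMap.ext fun n => ?_⟩
  · have h := LinearMap.congr_fun (hs x) y
    rw [homAct_apply_even hx] at h
    exact (sub_eq_zero.mp h).symm
  · have h := LinearMap.congr_fun (hs x) y
    rw [homAct_apply_odd hx, ← homPty_apply, hs'] at h
    exact (sub_eq_zero.mp h).symm
  · have h : ∀ i, (T' (b i) (b.coord i) : Y.carrier →ₗ[ℂ] P.carrier) (d n)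
        = b.repr (e n) i • b i := fun i =>
      LinearMap.congr_fun (LinearMap.congr_fun (LinearMap.congr_fun hpT (b i)) (b.coord i)) n
    change (∑ i, (T' (b i) (b.coord i) : Y.carrier →ₗ[ℂ] P.carrier)) (d n) = e n
    rw [LinearMap.sum_apply]
    simp only [h]
    exact b.sum_repr (e n)

lemma HasLifting.shift (hP : P.HasLifting) : P.shift.HasLifting :=
  fun M N hM hN p hp hps f hf => hP M N hM hN p hp hps f hf

/-- Extension of intertwiners into `P` along even intertwiners. -/
lemma HasLifting.exists_extension_along_even (hg : g.IsClassical) (hPF : P.MemF)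
    (hP : P.HasLifting) (hX : X.MemF) (hY : Y.MemF) {d : X.carrier →ₗ[ℂ] Y.carrier}
    (hd : IsIntertwiner X Y d) (hd' : IsEvenMap X Y d) {e : X.carrier →ₗ[ℂ] P.carrier}
    (he : IsIntertwiner X P e) (hde : LinearMap.ker d ≤ LinearMap.ker e) :
    ∃ s : Y.carrier →ₗ[ℂ] P.carrier, IsIntertwiner Y P s ∧ s ∘ₗ d = e := by
  have hker : ∀ m, d m = 0 → e m = 0 := fun m hm => hde hm
  have hker' : ∀ m, d m = 0 → e (X.pty m) = 0 := fun m hm =>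
    hker _ (by rw [hd', hm, map_zero])
  obtain ⟨s₀, hs₀, hs₀'⟩ := hP.exists_extension_of_even hg hPF hX hY
    hd hd' (e := (1 / 2 : ℂ) • (e + P.pty ∘ₗ e ∘ₗ X.pty))
    ((he.add he.pty_conj).smul _) (fun m => by simp [add_comm])
    (fun m hm => by simp [hker m hm, hker' m hm])
  obtain ⟨s₁, hs₁, hs₁'⟩ := hP.shift.exists_extension_of_even hg hPF.shift hX
    hY hd hd' (e := (1 / 2 : ℂ) • (e - P.pty ∘ₗ e ∘ₗ X.pty))
    ((he.sub he.pty_conj).smul _) (fun m => by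
      rw [shift_pty]
      change (1 / 2 : ℂ) • (e (X.pty m) - P.pty (e (X.pty (X.pty m))))
        = - P.pty ((1 / 2 : ℂ) • (e m - P.pty (e (X.pty m))))
      simp only [map_smul, map_sub, SuperVS.pty_pty, ← smul_neg, neg_sub])
    (fun m hm => by
      change (1 / 2 : ℂ) • (e m - P.pty (e (X.pty m))) = 0
      rw [hker m hm, hker' m hm, map_zero, sub_zero, smul_zero])
  refine ⟨s₀ + s₁, IsIntertwiner.add (N := P) hs₀ hs₁, LinearMap.ext fun n => ?_⟩
  refine (congrArg₂ (fun a b : P.carrier => a + b) (LinearMap.congr_fun hs₀' n)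
    (LinearMap.congr_fun hs₁' n)).trans ?_
  change (1 / 2 : ℂ) • (e n + P.pty (e (X.pty n)))
    + (1 / 2 : ℂ) • (e n - P.pty (e (X.pty n))) = e n
  module

/-- Self-injectivity: an intertwiner into a projective object extends along any intertwiner whose
kernel it annihilates. -/
lemma HasLifting.exists_extension (hg : g.IsClassical) (hPF : P.MemF) (hP : P.HasLifting)
    (hX : X.MemF) (hY : Y.MemF) {d : X.carrier →ₗ[ℂ] Y.carrier} (hd : IsIntertwiner X Y d)
    {e : X.carrier →ₗ[ℂ] P.carrier} (he : IsIntertwiner X P e)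
    (hde : LinearMap.ker d ≤ LinearMap.ker e) :
    ∃ s : Y.carrier →ₗ[ℂ] P.carrier, IsIntertwiner Y P s ∧ s ∘ₗ d = e := by
  obtain ⟨s, hs, hsd⟩ := hP.exists_extension_along_even (X := X.double) (Y := Y.double) hg hPF
    (hX.double hg) (hY.double hg) (d := LinearMap.prodMap d d)
    (fun x m => Prod.ext (hd x m.1) (hd (g.pty x) m.2))
    (fun m => by rw [double_pty, double_pty]; rfl)
    (e := e ∘ₗ LinearMap.fst ℂ X.carrier X.carrier) (fun x m => he x m.1)
    (fun m hm => hde (congrArg Prod.fst hm))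
  refine ⟨s ∘ₗ LinearMap.inl ℂ Y.carrier Y.carrier, fun x y => ?_, LinearMap.ext fun n => ?_⟩
  · refine Eq.trans ?_ (hs x (y, 0))
    exact congrArg s (Prod.ext rfl (map_zero (Y.act (g.pty x))).symm)
  · refine Eq.trans ?_ (LinearMap.congr_fun hsd (n, 0))
    exact congrArg s (Prod.ext rfl (map_zero d).symm)

lemma HasLifting.of_retract {Q : g.SuperModule} (hP : P.HasLifting)
    {r : P.carrier →ₗ[ℂ] Q.carrier} (hr : IsIntertwiner P Q r) {i : Q.carrier →ₗ[ℂ] P.carrier}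
    (hi : IsIntertwiner Q P i) (hri : r ∘ₗ i = LinearMap.id) : Q.HasLifting := by
  intro M N hM hN p hp hps f hf
  obtain ⟨h, hh, hh'⟩ := hP M N hM hN p hp hps (f ∘ₗ r) (hf.comp hr)
  exact ⟨h ∘ₗ i, hh.comp hi, by
    rw [← LinearMap.comp_assoc, hh', LinearMap.comp_assoc, hri, LinearMap.comp_id]⟩

end SuperModule

end LieSuperAlgebra

lemma growthRate_eq_zero_iff {f : ℕ → ℕ} : growthRate f = 0 ↔ HasGrowthRateLE f 0 := by
  refine ⟨fun h => ?_, fun h => le_antisymm (sInf_le ⟨0, rfl, h⟩) zero_le⟩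
  have hne : {c : ℕ∞ | ∃ c' : ℕ, c = (c' : ℕ∞) ∧ HasGrowthRateLE f c'}.Nonempty := by
    by_contra hne
    rw [Set.not_nonempty_iff_eq_empty] at hne
    rw [growthRate, hne, sInf_empty] at h
    exact ENat.top_ne_zero h
  obtain ⟨c, hc, hf⟩ := csInf_mem hne
  have hc0 : c = 0 := by exact_mod_cast hc.symm.trans h
  rwa [hc0] at hf

lemma HasGrowthRateLE.exists_eq_zero {f : ℕ → ℕ} (h : HasGrowthRateLE f 0) :
    ∃ n, ∀ t, n ≤ t → f t = 0 := by
  obtain ⟨C, -, hf⟩ := h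
  obtain ⟨n, hn⟩ := exists_nat_gt C
  refine ⟨n + 1, fun t ht => ?_⟩
  have ht0 : (0 : ℝ) < t := by exact_mod_cast (by omega : 0 < t)
  have htC : C < t := hn.trans_le (by exact_mod_cast (by omega : n ≤ t))
  have h := hf t (by omega)
  rw [Nat.cast_zero, zero_sub, Real.rpow_neg_one] at h
  have h1 : (f t : ℝ) < 1 := h.trans_lt (by
    rw [← div_eq_mul_inv, div_lt_one ht0]; exact htC)
  exact Nat.lt_one_iff.mp (by exact_mod_cast h1)

lemma hasGrowthRateLE_zero_of_forall_eq_zero {f : ℕ → ℕ} (h : ∀ t, 1 ≤ t → f t = 0) :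
    HasGrowthRateLE f 0 :=
  ⟨1, one_pos, fun t ht => by rw [h t ht]; simp; positivity⟩

namespace LieSuperAlgebra

variable {g : LieSuperAlgebra}

namespace SuperModule

variable {M N : g.SuperModule}

/-- The intertwiner attached to a supermodule homomorphism. -/
def intertwinerOfSuperHom (f : g.SuperHom M N) : M.carrier →ₗ[ℂ] N.carrier :=
  N.twist ∘ₗ f.toLinearMap ∘ₗ M.untwist

lemma range_intertwinerOfSuperHom_eq_ker {L : g.SuperModule} {f : g.SuperHom L M}
    {f' : g.SuperHom M N} (h : LinearMap.range f.toLinearMap = LinearMap.ker f'.toLinearMap) :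
    LinearMap.range (intertwinerOfSuperHom f) = LinearMap.ker (intertwinerOfSuperHom f') := by
  ext m
  constructor
  · rintro ⟨l, rfl⟩
    have h1 : f.toLinearMap (L.untwist l) ∈ LinearMap.ker f'.toLinearMap := h ▸ ⟨_, rfl⟩
    simp [intertwinerOfSuperHom, LinearMap.mem_ker.mp h1]
  · intro hm
    have h0 := congrArg N.untwist (LinearMap.mem_ker.mp hm)
    simp only [intertwinerOfSuperHom, LinearMap.comp_apply, untwist_twist, map_zero] at h0
    have h1 : M.untwist m ∈ LinearMap.range f.toLinearMap := h ▸ LinearMap.mem_ker.mpr h0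
    obtain ⟨l, hl⟩ := h1
    exact ⟨L.twist l, by simp [intertwinerOfSuperHom, hl]⟩

lemma intertwinerOfSuperHom_surjective {f : g.SuperHom M N}
    (h : Function.Surjective f.toLinearMap) :
    Function.Surjective (intertwinerOfSuperHom f) := fun n => by
  obtain ⟨m, hm⟩ := h (N.untwist n)
  exact ⟨M.twist m, by simp [intertwinerOfSuperHom, hm]⟩

/-- In an exact sequence `X → P → Y` of intertwiners with `P` projective, a generalized inverse of
the first map yields one of the second. -/
lemma HasLifting.exists_generalized_inverse {P X Y : g.SuperModule} (hg : g.IsClassical)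
    (hPF : P.MemF) (hP : P.HasLifting) (hY : Y.MemF) {d : X.carrier →ₗ[ℂ] P.carrier}
    (hd : IsIntertwiner X P d) {d' : P.carrier →ₗ[ℂ] Y.carrier} (hd' : IsIntertwiner P Y d')
    (hdd' : LinearMap.range d = LinearMap.ker d') {s : P.carrier →ₗ[ℂ] X.carrier}
    (hs : IsIntertwiner P X s) (hds : d ∘ₗ s ∘ₗ d = d) :
    ∃ s' : Y.carrier →ₗ[ℂ] P.carrier, IsIntertwiner Y P s' ∧ d' ∘ₗ s' ∘ₗ d' = d' := by
  obtain ⟨s', hs', hs'd⟩ := hP.exists_extension hg hPF hPF hY hd'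
    (e := LinearMap.id - d ∘ₗ s) (isIntertwiner_id.sub (hd.comp hs)) (by
      rw [← hdd']
      rintro _ ⟨x, rfl⟩
      have h := LinearMap.congr_fun hds x
      simp only [LinearMap.comp_apply] at h
      simp [h])
  refine ⟨s', hs', LinearMap.ext fun v => ?_⟩
  have h0 : d' (d (s v)) = 0 := LinearMap.mem_ker.mp (hdd' ▸ ⟨s v, rfl⟩)
  rw [hs'd]
  simp [h0]

end SuperModule

namespace ProjResF

open SuperModule

variable {M : g.SuperModule}

lemma isProjectiveInF_of_dims_eq_zero (hg : g.IsClassical) (hM : M.MemF) (R : g.ProjResF M)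
    {n : ℕ} (hn : R.dims n = 0) : g.IsProjectiveInF M := by
  have hP : ∀ k, (R.P k).MemF ∧ (R.P k).HasLifting := fun k =>
    isProjectiveInF_iff.mp (R.projective k)
  have hd : ∀ k, IsIntertwiner _ _ (intertwinerOfSuperHom (R.d k)) := fun k =>
    isIntertwiner_of_superHom _
  have key : ∃ s : (R.P 0).carrier →ₗ[ℂ] (R.P 1).carrier, IsIntertwiner _ _ s ∧
      intertwinerOfSuperHom (R.d 0) ∘ₗ s ∘ₗ intertwinerOfSuperHom (R.d 0)
        = intertwinerOfSuperHom (R.d 0) := by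
    refine Nat.decreasingInduction (n := n)
      (motive := fun k _ => ∃ s : (R.P k).carrier →ₗ[ℂ] (R.P (k + 1)).carrier,
        IsIntertwiner _ _ s ∧
        intertwinerOfSuperHom (R.d k) ∘ₗ s ∘ₗ intertwinerOfSuperHom (R.d k)
          = intertwinerOfSuperHom (R.d k)) ?_ ?_ n.zero_le
    · rintro k - ⟨s, hs, hds⟩
      exact (hP (k + 1)).2.exists_generalized_inverse hg (hP (k + 1)).1 (hP k).1 (hd (k + 1))
        (hd k) (range_intertwinerOfSuperHom_eq_ker (R.exact k)) hs hds
    · have := (hP n).1.1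
      have : Subsingleton (R.P n).carrier := finrank_zero_iff.mp hn
      exact ⟨0, fun x m => by simp, LinearMap.ext fun v => Subsingleton.elim _ _⟩
  obtain ⟨s, hs, hds⟩ := key
  have haug := isIntertwiner_of_superHom R.aug
  obtain ⟨i, hi, hai⟩ := (hP 0).2.exists_generalized_inverse hg (hP 0).1 hM (hd 0) haug
    (range_intertwinerOfSuperHom_eq_ker R.exact_at_zero) hs hds
  refine isProjectiveInF_iff.mpr ⟨hM, (hP 0).2.of_retract haug hi (LinearMap.ext fun m => ?_)⟩
  obtain ⟨v, rfl⟩ := intertwinerOfSuperHom_surjective R.aug_surjective m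
  exact LinearMap.congr_fun hai v

/-- The resolution of a projective object concentrated in degree zero. -/
def ofProjective (hM : g.IsProjectiveInF M) : g.ProjResF M where
  P n := Nat.casesOn n M fun _ => trivial g PUnit
  d n := superHomOfIntertwiner 0 fun x m => by simp
  aug := superHomOfIntertwiner LinearMap.id isIntertwiner_id
  projective n := by
    cases n with
    | zero => exact hM
    | succ n =>
      refine isProjectiveInF_iff.mpr ⟨memF_trivial _, fun _ _ _ _ _ _ _ f _ => ?_⟩
      exact ⟨0, fun x m => by simp, LinearMap.ext fun (v : PUnit) => by
        rw [show v = 0 from rfl, map_zero, map_zero]⟩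
  aug_surjective m := ⟨m, by simp [superHomOfIntertwiner]⟩
  exact_at_zero := by
    ext m
    simp [superHomOfIntertwiner]
  exact n := by
    ext (m : PUnit)
    exact ⟨fun _ => by simp [superHomOfIntertwiner],
      fun _ => ⟨0, Subsingleton.elim (α := PUnit) _ _⟩⟩

lemma dims_ofProjective (hM : g.IsProjectiveInF M) {n : ℕ} (hn : 1 ≤ n) :
    (ofProjective hM).dims n = 0 := by
  obtain ⟨n, rfl⟩ := Nat.exists_eq_succ_of_ne_zero (by omega : n ≠ 0)
  exact finrank_zero_of_subsingleton (R := ℂ) (M := PUnit)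

end ProjResF

end LieSuperAlgebra

open LieSuperAlgebra in
theorem complexity_zero_iff_projective
    (g : LieSuperAlgebra) (hg : g.IsClassical)
    (M : g.SuperModule) (hM : M.MemF)
    (R : g.ProjResF M) (hR : R.IsMinimal) :
    growthRate R.dims = 0 ↔ g.IsProjectiveInF M := by
  rw [growthRate_eq_zero_iff]
  constructor
  · intro h
    obtain ⟨n, hn⟩ := h.exists_eq_zero
    exact R.isProjectiveInF_of_dims_eq_zero hg hM (hn n le_rfl)
  · exact fun hP => hasGrowthRateLE_zero_of_forall_eq_zero fun t ht =>
      Nat.le_zero.mp ((hR (ProjResF.ofProjective hP) t).trans_eq (ProjResF.dims_ofProjective hP ht))
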